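/- Let m, r ∈ ℝ, 0 < p, q ≤ ∞, and σ ∈ S^m(ℝ^{2d}). Then the Born–Jordan operator Op_{BJ}(σ) extends to a bounded operator from M^{p,q}_{⟨·⟩^{r+m}}(ℝ^d) to M^{p,q}_{⟨·⟩^r}(ℝ^d). -/

import Mathlib

open scoped Real BigOperators
open Complex MeasureTheory

noncomputable section

variable {d : ℕ}

/-- The Japanese bracket on phase space `ℝ^{2d} = ℝ^d × ℝ^d` (Euclidean norm). -/
def jb2 (w : (Fin d → ℝ) × (Fin d → ℝ)) : ℝ :=
  Real.sqrt (1 + ∑ i, (w.1 i) ^ 2 + ∑ i, (w.2 i) ^ 2)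

/-- Directional derivative operator. -/
def pdir {E : Type*} [NormedAddCommGroup E] [NormedSpace ℝ E] (v : E) (h : E → ℂ) : E → ℂ :=
  fun y => fderiv ℝ h y v

/-- Iterated directional derivatives along a list of directions. -/
def mpdList {E : Type*} [NormedAddCommGroup E] [NormedSpace ℝ E]
    (vs : List E) (h : E → ℂ) : E → ℂ :=
  vs.foldr pdir h

/-- The list of coordinate directions encoding the multi-index `α`. -/
def stdList (d : ℕ) (α : Fin d → ℕ) : List (Fin d → ℝ) :=
  (List.finRange d).flatMap fun i => List.replicate (α i) (Pi.single i 1)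

/-- Directions on phase space encoding a multi-index on `ℝ^{2d}`. -/
def stdList2 (d : ℕ) (α : (Fin d → ℕ) × (Fin d → ℕ)) :
    List ((Fin d → ℝ) × (Fin d → ℝ)) :=
  ((stdList d α.1).map fun v => (v, 0)) ++ ((stdList d α.2).map fun v => (0, v))

/-- The multi-index partial derivative `∂^α` on phase space. -/
def mpd2 (α : (Fin d → ℕ) × (Fin d → ℕ)) (h : (Fin d → ℝ) × (Fin d → ℝ) → ℂ) :
    (Fin d → ℝ) × (Fin d → ℝ) → ℂ :=
  mpdList (stdList2 d α) h

/-- The Hörmander-type symbol class `S^m(ℝ^{2d})`. -/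
def SmSymbol (d : ℕ) (m : ℝ) (σ : (Fin d → ℝ) × (Fin d → ℝ) → ℂ) : Prop :=
  ContDiff ℝ (⊤ : ℕ∞) σ ∧
    ∀ α : (Fin d → ℕ) × (Fin d → ℕ), ∃ C : ℝ, ∀ z, ‖mpd2 α σ z‖ ≤ C * jb2 z ^ m

/-- The seminorm `|σ|_{n,m} = sup_{|α| ≤ n} sup_z |∂^α σ(z)| ⟨z⟩^{-m}`. -/
def smSeminorm (d : ℕ) (n : ℕ) (m : ℝ) (σ : (Fin d → ℝ) × (Fin d → ℝ) → ℂ) : ℝ :=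
  sSup {r | ∃ α : (Fin d → ℕ) × (Fin d → ℕ), ∃ z,
    (∑ i, α.1 i) + (∑ i, α.2 i) ≤ n ∧ r = ‖mpd2 α σ z‖ * jb2 z ^ (-m)}

/-- The time-frequency shift `π(x,ω)f(t) = e^{2πiωt} f(t-x)`. -/
def tshift (w : (Fin d → ℝ) × (Fin d → ℝ)) (g : (Fin d → ℝ) → ℂ) :
    (Fin d → ℝ) → ℂ :=
  fun t => Complex.exp (2 * π * Complex.I * (∑ i, w.2 i * t i)) * g (t - w.1)

/-- The cross-τ-Wigner distribution. -/
def wig (τ : ℝ) (f h : (Fin d → ℝ) → ℂ) : (Fin d → ℝ) × (Fin d → ℝ) → ℂ :=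
  fun p => ∫ y : Fin d → ℝ,
    Complex.exp (-(2 * π * Complex.I * (∑ i, y i * p.2 i))) * f (p.1 + τ • y) *
      (starRingEnd ℂ) (h (p.1 - (1 - τ) • y))


/-- The short-time Fourier transform on `ℝ^d`. -/
def stft (g f : (Fin d → ℝ) → ℂ) (x ω : Fin d → ℝ) : ℂ :=
  ∫ y : Fin d → ℝ,
    Complex.exp (-(2 * π * Complex.I * (∑ i, ω i * y i))) * f y *
      (starRingEnd ℂ) (g (y - x))


/-- The STFT (with window `g`) of the Born–Jordan operator `Op_{BJ}(σ) f`, computed via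
`V_g(Op_{BJ}(σ)f)(x,ω) = ⟨σ, W_{BJ}(M_ω T_x g, f)⟩`, `W_{BJ}(h,f) = ∫₀¹ W_τ(h,f) dτ`. -/
def vOpBJ (σ : (Fin d → ℝ) × (Fin d → ℝ) → ℂ) (g f : (Fin d → ℝ) → ℂ)
    (x ω : Fin d → ℝ) : ℂ :=
  ∫ p : (Fin d → ℝ) × (Fin d → ℝ),
    σ p * (starRingEnd ℂ) (∫ τ in (0 : ℝ)..1, wig τ (tshift (x, ω) g) f p)
open scoped ENNReal in
/-- The (quasi-)norm of the modulation space `M^{p,q}_{⟨·⟩^r}(ℝ^d)` (with weight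
`w(x,ω) = ⟨(x,ω)⟩^r`) of a generalized STFT `V`, for `0 < p,q ≤ ∞`. -/
def mixedModNorm (p q : ℝ≥0∞) (r : ℝ) (V : (Fin d → ℝ) → (Fin d → ℝ) → ℂ) : ℝ≥0∞ :=
  if q = ∞ then
    ⨆ ω, (if p = ∞ then
        ⨆ x, (‖V x ω‖₊ : ℝ≥0∞) * ENNReal.ofReal (jb2 (x, ω) ^ r)
      else
        (∫⁻ x : Fin d → ℝ,
          ((‖V x ω‖₊ : ℝ≥0∞) * ENNReal.ofReal (jb2 (x, ω) ^ r)) ^ p.toReal) ^ (1 / p.toReal))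
  else
    (∫⁻ ω : Fin d → ℝ,
      (if p = ∞ then
          ⨆ x, (‖V x ω‖₊ : ℝ≥0∞) * ENNReal.ofReal (jb2 (x, ω) ^ r)
        else
          (∫⁻ x : Fin d → ℝ,
            ((‖V x ω‖₊ : ℝ≥0∞) * ENNReal.ofReal (jb2 (x, ω) ^ r)) ^ p.toReal) ^
              (1 / p.toReal)) ^ q.toReal) ^ (1 / q.toReal)

/-- The weight `(1 + ‖x‖)^(-N)`. -/
def decayWeight {E : Type*} [NormedAddCommGroup E] (N : ℝ) (x : E) : ℝ := (1 + ‖x‖) ^ (-N)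

section DecayWeight

variable {E : Type*} [NormedAddCommGroup E]

lemma decayWeight_pos (N : ℝ) (x : E) : 0 < decayWeight N x := by
  unfold decayWeight; positivity

lemma decayWeight_nonneg (N : ℝ) (x : E) : 0 ≤ decayWeight N x := (decayWeight_pos N x).le

lemma decayWeight_le_one {N : ℝ} (hN : 0 ≤ N) (x : E) : decayWeight N x ≤ 1 :=
  Real.rpow_le_one_of_one_le_of_nonpos (by linarith [norm_nonneg x]) (by linarith)

lemma decayWeight_anti {N M : ℝ} (h : N ≤ M) (x : E) : decayWeight M x ≤ decayWeight N x :=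
  Real.rpow_le_rpow_of_exponent_le (by linarith [norm_nonneg x]) (by linarith)

lemma decayWeight_add (N M : ℝ) (x : E) :
    decayWeight (N + M) x = decayWeight N x * decayWeight M x := by
  unfold decayWeight
  rw [neg_add, Real.rpow_add (by positivity)]

lemma decayWeight_neg_mul (N : ℝ) (x : E) : decayWeight (-N) x * decayWeight N x = 1 := by
  rw [← decayWeight_add]; simp [decayWeight]

lemma decayWeight_neg (N : ℝ) (x : E) : decayWeight N (-x) = decayWeight N x := by
  simp [decayWeight]

lemma decayWeight_le_of_norm_le {F : Type*} [NormedAddCommGroup F] {N : ℝ} (hN : 0 ≤ N)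
    {x : E} {y : F} (h : ‖y‖ ≤ ‖x‖) : decayWeight N x ≤ decayWeight N y :=
  Real.rpow_le_rpow_of_nonpos (by positivity) (by linarith) (by linarith)

lemma one_add_norm_add_le (a b : E) : 1 + ‖a + b‖ ≤ (1 + ‖a‖) * (1 + ‖b‖) := by
  nlinarith [norm_add_le a b, norm_nonneg a, norm_nonneg b, mul_nonneg (norm_nonneg a) (norm_nonneg b)]

lemma decayWeight_mul_le {N : ℝ} (hN : 0 ≤ N) (a b : E) :
    decayWeight N a * decayWeight N b ≤ decayWeight N (a + b) := by
  unfold decayWeight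
  rw [← Real.mul_rpow (by positivity) (by positivity)]
  exact Real.rpow_le_rpow_of_nonpos (by positivity) (one_add_norm_add_le a b) (by linarith)

lemma decayWeight_le_mul {N : ℝ} (hN : 0 ≤ N) (a b : E) :
    decayWeight N a ≤ decayWeight N b * decayWeight (-N) (b - a) := by
  have h := decayWeight_mul_le hN a (b - a)
  rw [add_sub_cancel] at h
  calc decayWeight N a = decayWeight N a * decayWeight N (b - a) * decayWeight (-N) (b - a) := by
        rw [mul_assoc, mul_comm (decayWeight N (b - a)), decayWeight_neg_mul, mul_one]
    _ ≤ _ := mul_le_mul_of_nonneg_right h (decayWeight_nonneg _ _)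

lemma continuous_decayWeight (N : ℝ) : Continuous (decayWeight N : E → ℝ) := by
  unfold decayWeight
  exact (by fun_prop : Continuous fun x : E => 1 + ‖x‖).rpow_const
    fun x => Or.inl (by positivity)

lemma decayWeight_mul_pow (n : ℕ) (x : E) : decayWeight n x * (1 + ‖x‖) ^ n = 1 := by
  unfold decayWeight
  rw [← Real.rpow_natCast, ← Real.rpow_add (by positivity)]; simp

lemma le_decayWeight_of_mul_pow_le {n : ℕ} {x : E} {A C : ℝ} (h : A * (1 + ‖x‖) ^ n ≤ C) :
    A ≤ C * decayWeight n x := by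
  calc A = A * (1 + ‖x‖) ^ n * decayWeight n x := by
        rw [mul_assoc, mul_comm (_ ^ n), decayWeight_mul_pow, mul_one]
    _ ≤ _ := mul_le_mul_of_nonneg_right h (decayWeight_nonneg _ _)

lemma integrable_decayWeight [NormedSpace ℝ E] [FiniteDimensional ℝ E] [MeasurableSpace E]
    [BorelSpace E] (μ : Measure E) [μ.IsAddHaarMeasure] {N : ℝ}
    (hN : (Module.finrank ℝ E : ℝ) < N) : Integrable (decayWeight N : E → ℝ) μ :=
  integrable_one_add_norm hN

end DecayWeight

lemma le_decayWeight_of_coord {n : ℕ} {z : (Fin d → ℝ) × (Fin d → ℝ)} {A C : ℝ} (hA : 0 ≤ A)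
    (h0 : A ≤ C) (h1 : ∀ i, |z.1 i| ^ n * A ≤ C) (h2 : ∀ i, |z.2 i| ^ n * A ≤ C) :
    A ≤ 2 ^ n * C * decayWeight n z := by
  apply le_decayWeight_of_mul_pow_le
  have hC : 0 ≤ C := hA.trans h0
  have key : ∀ t : ℝ, 0 ≤ t → t ^ n * A ≤ C → A * (1 + t) ^ n ≤ 2 ^ n * C := by
    intro t ht h
    rcases le_total t 1 with h1 | h1
    · calc A * (1 + t) ^ n ≤ C * 2 ^ n := by gcongr; linarith
        _ = _ := mul_comm _ _
    · calc A * (1 + t) ^ n ≤ A * (2 * t) ^ n := by gcongr; linarith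
        _ = 2 ^ n * (t ^ n * A) := by rw [mul_pow]; ring
        _ ≤ _ := by gcongr
  have key2 : ∀ x : Fin d → ℝ, (∀ i, |x i| ^ n * A ≤ C) → A * (1 + ‖x‖) ^ n ≤ 2 ^ n * C := by
    intro x hx
    rcases isEmpty_or_nonempty (Fin d) with he | he
    · have : ‖x‖ = 0 := by rw [norm_eq_zero]; exact Subsingleton.elim _ _
      rw [this]
      calc A * (1 + 0) ^ n = 1 * A := by simp
        _ ≤ 2 ^ n * C := by gcongr; exact one_le_pow₀ (by norm_num)
    · obtain ⟨i, hi⟩ := Finite.exists_max fun i => ‖x i‖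
      have : ‖x‖ = |x i| :=
        le_antisymm ((pi_norm_le_iff_of_nonneg (norm_nonneg _)).2 hi) (norm_le_pi_norm x i)
      exact key _ (norm_nonneg _) (by rw [this]; exact hx i)
  rcases max_choice ‖z.1‖ ‖z.2‖ with h | h
  · rw [Prod.norm_def, h]; exact key2 _ h1
  · rw [Prod.norm_def, h]; exact key2 _ h2

lemma one_le_jb2 (z : (Fin d → ℝ) × (Fin d → ℝ)) : 1 ≤ jb2 z := by
  unfold jb2
  rw [Real.one_le_sqrt]
  have := Finset.sum_nonneg fun i (_ : i ∈ Finset.univ) => sq_nonneg (z.1 i)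
  have := Finset.sum_nonneg fun i (_ : i ∈ Finset.univ) => sq_nonneg (z.2 i)
  linarith

lemma jb2_pos (z : (Fin d → ℝ) × (Fin d → ℝ)) : 0 < jb2 z := one_pos.trans_le (one_le_jb2 z)

lemma continuous_jb2_rpow (s : ℝ) :
    Continuous fun z : (Fin d → ℝ) × (Fin d → ℝ) => jb2 z ^ s := by
  refine Continuous.rpow_const ?_ fun z => Or.inl (jb2_pos z).ne'
  unfold jb2
  fun_prop

lemma jb2_le_one_add_norm (z : (Fin d → ℝ) × (Fin d → ℝ)) :
    jb2 z ≤ (1 + 2 * d) * (1 + ‖z‖) := by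
  have key : ∀ x : Fin d → ℝ, ‖x‖ ≤ ‖z‖ → ∑ i, x i ^ 2 ≤ d * ‖z‖ ^ 2 := by
    intro x hx
    calc ∑ i, x i ^ 2 ≤ ∑ _i : Fin d, ‖z‖ ^ 2 := by
          refine Finset.sum_le_sum fun i _ => sq_le_sq' ?_ ?_
          · linarith [neg_abs_le (x i), (norm_le_pi_norm x i).trans hx, Real.norm_eq_abs (x i)]
          · linarith [le_abs_self (x i), (norm_le_pi_norm x i).trans hx, Real.norm_eq_abs (x i)]
      _ = _ := by simp
  have h1 := key z.1 (norm_fst_le z)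
  have h2 := key z.2 (norm_snd_le z)
  unfold jb2
  apply Real.sqrt_le_iff.2 ⟨by positivity, ?_⟩
  have hd : (0 : ℝ) ≤ d := d.cast_nonneg
  have hz := norm_nonneg z
  have : (1 + 2 * (d : ℝ)) ≤ (1 + 2 * d) ^ 2 := by nlinarith
  calc _ ≤ 1 + 2 * (d : ℝ) * ‖z‖ ^ 2 := by linarith
    _ ≤ (1 + 2 * d) * (1 + ‖z‖) ^ 2 := by nlinarith [mul_nonneg hd hz]
    _ ≤ (1 + 2 * d) ^ 2 * (1 + ‖z‖) ^ 2 := by gcongr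
    _ = _ := by ring

lemma one_add_norm_le_jb2 (z : (Fin d → ℝ) × (Fin d → ℝ)) : 1 + ‖z‖ ≤ 2 * jb2 z := by
  have h1 := Finset.sum_nonneg fun i (_ : i ∈ Finset.univ) => sq_nonneg (z.1 i)
  have h2 := Finset.sum_nonneg fun i (_ : i ∈ Finset.univ) => sq_nonneg (z.2 i)
  have key : ‖z‖ ≤ jb2 z := by
    rw [Prod.norm_def]
    refine max_le ?_ ?_ <;> refine (pi_norm_le_iff_of_nonneg (jb2_pos z).le).2 fun i => ?_
    · refine Real.le_sqrt_of_sq_le ?_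
      have := Finset.single_le_sum (fun i (_ : i ∈ Finset.univ) => sq_nonneg (z.1 i))
        (Finset.mem_univ i)
      rw [Real.norm_eq_abs, sq_abs]; linarith
    · refine Real.le_sqrt_of_sq_le ?_
      have := Finset.single_le_sum (fun i (_ : i ∈ Finset.univ) => sq_nonneg (z.2 i))
        (Finset.mem_univ i)
      rw [Real.norm_eq_abs, sq_abs]; linarith
  linarith [one_le_jb2 z]

lemma jb2_le_mul (z w : (Fin d → ℝ) × (Fin d → ℝ)) :
    jb2 z ≤ 2 * (1 + 2 * d) * jb2 w * (1 + ‖z - w‖) := by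
  have h := one_add_norm_add_le w (z - w)
  rw [add_sub_cancel] at h
  calc jb2 z ≤ (1 + 2 * d) * (1 + ‖z‖) := jb2_le_one_add_norm z
    _ ≤ (1 + 2 * d) * (2 * jb2 w * (1 + ‖z - w‖)) := by
        gcongr
        exact h.trans (by gcongr; exact one_add_norm_le_jb2 w)
    _ = _ := by ring

/-- Peetre's inequality. -/
lemma exists_jb2_rpow_le (d : ℕ) (s : ℝ) : ∃ C : ℝ, 0 < C ∧
    ∀ z w : (Fin d → ℝ) × (Fin d → ℝ), jb2 z ^ s ≤ C * jb2 w ^ s * decayWeight (-|s|) (z - w) := by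
  refine ⟨(2 * (1 + 2 * d)) ^ |s|, by positivity, fun z w => ?_⟩
  have hz := jb2_pos z
  have hw := jb2_pos w
  unfold decayWeight
  rw [neg_neg]
  rcases le_total 0 s with hs | hs
  · rw [abs_of_nonneg hs, ← Real.mul_rpow (by positivity) hw.le,
      ← Real.mul_rpow (by positivity) (by positivity)]
    exact Real.rpow_le_rpow hz.le (jb2_le_mul z w) hs
  · rw [abs_of_nonpos hs]
    have h : jb2 w ^ (-s) ≤ (2 * (1 + 2 * d)) ^ (-s) * jb2 z ^ (-s) * (1 + ‖z - w‖) ^ (-s) := by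
      rw [← Real.mul_rpow (by positivity) hz.le, ← Real.mul_rpow (by positivity) (by positivity),
        norm_sub_rev]
      exact Real.rpow_le_rpow hw.le (jb2_le_mul w z) (by linarith)
    have e1 : jb2 z ^ s * jb2 z ^ (-s) = 1 := by rw [← Real.rpow_add hz]; simp
    have e2 : jb2 w ^ s * jb2 w ^ (-s) = 1 := by rw [← Real.rpow_add hw]; simp
    calc jb2 z ^ s = jb2 z ^ s * jb2 w ^ s * jb2 w ^ (-s) := by rw [mul_assoc, e2, mul_one]
      _ ≤ jb2 z ^ s * jb2 w ^ s *
          ((2 * (1 + 2 * d)) ^ (-s) * jb2 z ^ (-s) * (1 + ‖z - w‖) ^ (-s)) := by gcongr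
      _ = jb2 z ^ s * jb2 z ^ (-s) * (jb2 w ^ s *
          ((2 * (1 + 2 * d)) ^ (-s) * (1 + ‖z - w‖) ^ (-s))) := by ring
      _ = _ := by rw [e1]; ring

section Oscillation

open scoped SchwartzMap LineDeriv

/-- The oscillation `e^{-2πit}`. -/
def osc (t : ℝ) : ℂ := cexp (-(2 * π * I * t))

lemma norm_osc (t : ℝ) : ‖osc t‖ = 1 := by
  rw [osc, show -(2 * π * I * (t : ℂ)) = ((-(2 * π * t) : ℝ) : ℂ) * I by push_cast; ring,
    norm_exp_ofReal_mul_I]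

lemma osc_add (s t : ℝ) : osc (s + t) = osc s * osc t := by
  rw [osc, osc, osc, ← Complex.exp_add]; congr 1; push_cast; ring

lemma conj_osc (t : ℝ) : (starRingEnd ℂ) (osc t) = osc (-t) := by
  rw [osc, osc, ← Complex.exp_conj]; congr 1; simp [map_ofNat]

@[fun_prop]
lemma continuous_osc : Continuous osc := by unfold osc; fun_prop

lemma hasDerivAt_osc (t : ℝ) : HasDerivAt osc (osc t * (-(2 * π * I))) t := by
  have h : HasDerivAt (fun t : ℝ => -(2 * π * I * (t : ℂ))) (-(2 * π * I * 1)) t :=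
    ((hasDerivAt_id t).ofReal_comp.const_mul _).neg
  refine h.cexp.congr_deriv ?_
  rw [mul_one, osc]

@[fun_prop]
lemma Continuous.dotProduct_pi {X : Type*} [TopologicalSpace X] {f g : X → Fin d → ℝ}
    (hf : Continuous f) (hg : Continuous g) : Continuous fun x => f x ⬝ᵥ g x := by
  unfold dotProduct; fun_prop

/-- Multiplication of a Schwartz function by the linear form `x ↦ x ⬝ᵥ w`. -/
def SchwartzMap.linMul (w : Fin d → ℝ) (f : 𝓢(Fin d → ℝ, ℂ)) : 𝓢(Fin d → ℝ, ℂ) :=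
  SchwartzMap.smulLeftCLM ℂ (fun x : Fin d → ℝ => x ⬝ᵥ w) f

lemma SchwartzMap.linMul_apply (w : Fin d → ℝ) (f : 𝓢(Fin d → ℝ, ℂ)) (x : Fin d → ℝ) :
    f.linMul w x = ((x ⬝ᵥ w : ℝ) : ℂ) * f x := by
  have h : (fun x : Fin d → ℝ => x ⬝ᵥ w) =
      (LinearMap.toContinuousLinearMap ((dotProductBilin ℝ ℝ).flip w) : (Fin d → ℝ) →L[ℝ] ℝ) := by
    ext x; simp
  have hg : (fun x : Fin d → ℝ => x ⬝ᵥ w).HasTemperateGrowth := by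
    rw [h]; exact ContinuousLinearMap.hasTemperateGrowth _
  rw [SchwartzMap.linMul, SchwartzMap.smulLeftCLM_apply_apply hg, Complex.real_smul]

/-- The directional derivative of a Schwartz function. -/
def SchwartzMap.dirDeriv (v : Fin d → ℝ) (f : 𝓢(Fin d → ℝ, ℂ)) : 𝓢(Fin d → ℝ, ℂ) := ∂_{v} f

lemma SchwartzMap.exists_le_decayWeight {E : Type*} [NormedAddCommGroup E] [NormedSpace ℝ E]
    (f : 𝓢(E, ℂ)) (n : ℕ) : ∃ C : ℝ, 0 ≤ C ∧ ∀ x, ‖f x‖ ≤ C * decayWeight n x := by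
  refine ⟨2 ^ n * (Finset.Iic (n, 0)).sup (fun m => SchwartzMap.seminorm ℝ m.1 m.2) f,
    by positivity, fun x => le_decayWeight_of_mul_pow_le ?_⟩
  have := SchwartzMap.one_add_le_sup_seminorm_apply (𝕜 := ℝ) (m := (n, 0)) le_rfl le_rfl f x
  rw [norm_iteratedFDeriv_zero, mul_comm] at this
  exact this

lemma SchwartzMap.hasDerivAt_comp (f : 𝓢(Fin d → ℝ, ℂ)) (u v : Fin d → ℝ) (a s : ℝ) :
    HasDerivAt (fun t : ℝ => f (u + (t * a) • v)) (a * f.dirDeriv v (u + (s * a) • v)) s := by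
  have h1 : HasDerivAt (fun t : ℝ => u + (t * a) • v) ((1 * a) • v) s :=
    (((hasDerivAt_id s).mul_const a).smul_const v).const_add u
  have h2 := (f.hasFDerivAt (u + (s * a) • v)).comp_hasDerivAt s h1
  rw [one_mul, map_smul, Complex.real_smul] at h2
  exact h2

/-- Coefficients of a unimodular linear change of variables `(x, y) ↦ (ax + by, cx + ey)` with
entries bounded by one. -/
structure UnimodularCoeff (a b c e δ : ℝ) : Prop where
  ha : |a| ≤ 1
  hb : |b| ≤ 1
  hc : |c| ≤ 1
  he : |e| ≤ 1
  det : a * e - b * c = δ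
  sq : δ * δ = 1

/-- The integrand of `ambFourier`. -/
def ambIntegrand (a b c e : ℝ) (f h : (Fin d → ℝ) → ℂ) (p : (Fin d → ℝ) × (Fin d → ℝ))
    (y : Fin d → ℝ) : ℂ :=
  osc (y ⬝ᵥ p.2) * f (a • p.1 + b • y) * (starRingEnd ℂ) (h (c • p.1 + e • y))

/-- The partial Fourier transform of `f ⊗ conj h` after a linear change of variables; both the
cross-Wigner distributions and the short-time Fourier transform are of this form. -/
def ambFourier (a b c e : ℝ) (f h : (Fin d → ℝ) → ℂ) (p : (Fin d → ℝ) × (Fin d → ℝ)) : ℂ :=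
  ∫ y, ambIntegrand a b c e f h p y

section Amb

variable {a b c e δ : ℝ}

lemma UnimodularCoeff.norm_le (H : UnimodularCoeff a b c e δ) (x y : Fin d → ℝ) :
    ‖y‖ ≤ ‖(a • x + b • y)‖ + ‖c • x + e • y‖ := by
  have h : δ • y = a • (c • x + e • y) - c • (a • x + b • y) := by
    rw [← H.det]; module
  have hδ : |δ| = 1 := by
    have := H.sq
    rw [← abs_mul_abs_self] at this
    nlinarith [abs_nonneg δ]
  calc ‖y‖ = ‖δ • y‖ := by rw [norm_smul, Real.norm_eq_abs, hδ, one_mul]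
    _ ≤ ‖a • (c • x + e • y)‖ + ‖c • (a • x + b • y)‖ := by rw [h]; exact norm_sub_le _ _
    _ = |a| * ‖(c • x + e • y)‖ + |c| * ‖a • x + b • y‖ := by
        rw [norm_smul, norm_smul, Real.norm_eq_abs, Real.norm_eq_abs]
    _ ≤ 1 * ‖(c • x + e • y)‖ + 1 * ‖a • x + b • y‖ := by gcongr; exacts [H.ha, H.hc]
    _ = _ := by ring

lemma UnimodularCoeff.decayWeight_mul_le (H : UnimodularCoeff a b c e δ) {N : ℝ} (hN : 0 ≤ N)
    (x y : Fin d → ℝ) :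
    decayWeight N (a • x + b • y) * decayWeight N (c • x + e • y) ≤ decayWeight N y := by
  unfold decayWeight
  rw [← Real.mul_rpow (by positivity) (by positivity)]
  refine Real.rpow_le_rpow_of_nonpos (by positivity) ?_ (by linarith)
  nlinarith [H.norm_le x y, norm_nonneg (a • x + b • y), norm_nonneg (c • x + e • y),
    mul_nonneg (norm_nonneg (a • x + b • y)) (norm_nonneg (c • x + e • y))]

lemma exists_norm_ambIntegrand_le (f h : 𝓢(Fin d → ℝ, ℂ)) (n : ℕ) : ∃ C : ℝ, 0 ≤ C ∧
    ∀ {a b c e δ : ℝ}, UnimodularCoeff a b c e δ → ∀ p y,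
      ‖ambIntegrand a b c e f h p y‖ ≤ C * decayWeight n y := by
  obtain ⟨C1, h1, H1⟩ := f.exists_le_decayWeight n
  obtain ⟨C2, h2, H2⟩ := h.exists_le_decayWeight n
  refine ⟨C1 * C2, by positivity, fun H p y => ?_⟩
  rw [ambIntegrand, norm_mul, norm_mul, norm_osc, one_mul, RCLike.norm_conj]
  have := decayWeight_nonneg n (y : Fin d → ℝ)
  refine (mul_le_mul (H1 _) (H2 _) (norm_nonneg _)
    (mul_nonneg h1 (decayWeight_nonneg _ _))).trans ?_
  rw [mul_mul_mul_comm]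
  exact mul_le_mul_of_nonneg_left (H.decayWeight_mul_le n.cast_nonneg _ _) (by positivity)

lemma continuous_ambIntegrand (f h : 𝓢(Fin d → ℝ, ℂ)) (p) :
    Continuous (ambIntegrand a b c e f h p) := by
  unfold ambIntegrand
  have := f.continuous
  have := h.continuous
  fun_prop

lemma integrable_decayWeight_pi (d : ℕ) :
    Integrable (decayWeight ((d + 1 : ℕ) : ℝ) : (Fin d → ℝ) → ℝ) :=
  integrable_decayWeight _ (by simp)

instance isAddHaarMeasure_phase :
    (volume : Measure ((Fin d → ℝ) × (Fin d → ℝ))).IsAddHaarMeasure :=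
  Measure.prod.instIsAddHaarMeasure _ _

lemma integrable_decayWeight_phase (d : ℕ) :
    Integrable (decayWeight ((2 * d + 1 : ℕ) : ℝ) : (Fin d → ℝ) × (Fin d → ℝ) → ℝ) :=
  integrable_decayWeight _ (by simp; linarith)

lemma integrable_ambIntegrand (H : UnimodularCoeff a b c e δ) (f h : 𝓢(Fin d → ℝ, ℂ)) (p) :
    Integrable (ambIntegrand a b c e f h p) := by
  obtain ⟨C, -, hC⟩ := exists_norm_ambIntegrand_le f h (d + 1)
  exact ((integrable_decayWeight_pi d).const_mul C).mono'
    (continuous_ambIntegrand f h p).aestronglyMeasurable (.of_forall fun y => hC H p y)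

lemma exists_norm_ambFourier_le (f h : 𝓢(Fin d → ℝ, ℂ)) : ∃ C : ℝ, 0 ≤ C ∧
    ∀ {a b c e δ : ℝ}, UnimodularCoeff a b c e δ → ∀ p, ‖ambFourier a b c e f h p‖ ≤ C := by
  obtain ⟨C, h0, hC⟩ := exists_norm_ambIntegrand_le f h (d + 1)
  refine ⟨C * ∫ y : Fin d → ℝ, decayWeight ((d + 1 : ℕ) : ℝ) y,
    mul_nonneg h0 (integral_nonneg fun y => decayWeight_nonneg _ _), fun H p => ?_⟩
  rw [← integral_const_mul]
  exact norm_integral_le_of_norm_le ((integrable_decayWeight_pi d).const_mul C)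
    (.of_forall fun y => hC H p y)

lemma dotProduct_fst_mul_ambFourier (H : UnimodularCoeff a b c e δ) (f h : 𝓢(Fin d → ℝ, ℂ))
    (p : (Fin d → ℝ) × (Fin d → ℝ)) (w : Fin d → ℝ) :
    ((p.1 ⬝ᵥ w : ℝ) : ℂ) * ambFourier a b c e f h p =
      δ * (e * ambFourier a b c e (f.linMul w) h p - b * ambFourier a b c e f (h.linMul w) p) := by
  unfold ambFourier
  rw [← integral_const_mul, ← integral_const_mul, ← integral_const_mul, ← integral_sub
    ((integrable_ambIntegrand H _ _ _).const_mul _) ((integrable_ambIntegrand H _ _ _).const_mul _),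
    ← integral_const_mul]
  refine integral_congr_ae (.of_forall fun y => ?_)
  simp only [ambIntegrand, SchwartzMap.linMul_apply, map_mul, conj_ofReal, add_dotProduct,
    smul_dotProduct, smul_eq_mul]
  have h1 : (a : ℂ) * e - b * c = δ := by exact_mod_cast congrArg ((↑) : ℝ → ℂ) H.det
  have h2 : (δ : ℂ) * δ = 1 := by exact_mod_cast congrArg ((↑) : ℝ → ℂ) H.sq
  push_cast
  set P : ℂ := ((p.1 ⬝ᵥ w : ℝ) : ℂ)
  set Y : ℂ := ((y ⬝ᵥ w : ℝ) : ℂ)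
  generalize osc _ = O
  generalize f _ = F
  generalize (starRingEnd ℂ) (h _) = G
  linear_combination (-P * O * F * G) * h2 - (δ * P * O * F * G) * h1

lemma dotProduct_snd_mul_ambFourier (H : UnimodularCoeff a b c e δ) (f h : 𝓢(Fin d → ℝ, ℂ))
    (p : (Fin d → ℝ) × (Fin d → ℝ)) (w : Fin d → ℝ) :
    (2 * π * I) * ((w ⬝ᵥ p.2 : ℝ) : ℂ) * ambFourier a b c e f h p =
      b * ambFourier a b c e (f.dirDeriv w) h p + e * ambFourier a b c e f (h.dirDeriv w) p := by
  set B : (Fin d → ℝ) → ℂ :=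
    fun y => f (a • p.1 + b • y) * (starRingEnd ℂ) (h (c • p.1 + e • y)) with hB
  set B' : (Fin d → ℝ) → ℂ := fun y =>
    b * (f.dirDeriv w (a • p.1 + b • y) * (starRingEnd ℂ) (h (c • p.1 + e • y))) +
    e * (f (a • p.1 + b • y) * (starRingEnd ℂ) (h.dirDeriv w (c • p.1 + e • y))) with hB'
  have e1 : ∀ y, osc (y ⬝ᵥ p.2) * B y = ambIntegrand a b c e f h p y := fun y => by
    simp only [hB, ambIntegrand]; ring
  have e2 : ∀ y, osc (y ⬝ᵥ p.2) * B' y = b * ambIntegrand a b c e (f.dirDeriv w) h p y +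
      e * ambIntegrand a b c e f (h.dirDeriv w) p y := fun y => by
    simp only [hB', ambIntegrand]; ring
  have i1 := (integrable_ambIntegrand H (f.dirDeriv w) h p).const_mul (b : ℂ)
  have i2 := (integrable_ambIntegrand H f (h.dirDeriv w) p).const_mul (e : ℂ)
  have ibp := integral_bilinear_hasLineDerivAt_right_eq_neg_left_of_integrable
    (μ := (volume : Measure (Fin d → ℝ))) (B := ContinuousLinearMap.mul ℝ ℂ) (v := w)
    (f := fun y => osc (y ⬝ᵥ p.2)) (f' := fun y => -(2 * π * I) * ((w ⬝ᵥ p.2 : ℝ) : ℂ) * osc (y ⬝ᵥ p.2))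
    (g := B) (g' := B') ?_ ?_ ?_ ?_ ?_
  · simp only [ContinuousLinearMap.mul_apply', e2, mul_assoc _ (osc _), e1] at ibp
    rw [integral_add i1 i2, integral_const_mul, integral_const_mul, integral_const_mul] at ibp
    unfold ambFourier
    rw [ibp]; ring
  · simp only [ContinuousLinearMap.mul_apply', mul_assoc _ (osc _), e1]
    exact (integrable_ambIntegrand H _ _ _).const_mul _
  · simp only [ContinuousLinearMap.mul_apply', e2]
    exact i1.add i2
  · simp only [ContinuousLinearMap.mul_apply', e1]
    exact integrable_ambIntegrand H _ _ _
  · intro y _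
    have h1 : HasDerivAt (fun t : ℝ => (y + t • w) ⬝ᵥ p.2) (w ⬝ᵥ p.2) 0 := by
      simp only [add_dotProduct, smul_dotProduct, smul_eq_mul]
      simpa using ((hasDerivAt_id (0 : ℝ)).mul_const (w ⬝ᵥ p.2)).const_add (y ⬝ᵥ p.2)
    have h2 := (hasDerivAt_osc _).scomp (0 : ℝ) h1
    refine h2.congr_deriv ?_
    rw [Complex.real_smul]; simp; ring
  · intro y _
    have h1 := f.hasDerivAt_comp (a • p.1 + b • y) w b 0
    have h2 := (h.hasDerivAt_comp (c • p.1 + e • y) w e 0).star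
    have h3 := h1.mul h2
    refine (h3.congr_deriv ?_).congr_of_eventuallyEq (.of_forall fun t => ?_)
    · simp [hB']; ring
    · simp only [hB, starRingEnd_apply, Pi.mul_apply]
      rw [show a • p.1 + b • (y + t • w) = a • p.1 + b • y + (t * b) • w by module,
        show c • p.1 + e • (y + t • w) = c • p.1 + e • y + (t * e) • w by module]

lemma hasDerivAt_osc_affine (α β s : ℝ) :
    HasDerivAt (fun t : ℝ => osc (α + t * β)) (β * (osc (α + s * β) * (-(2 * π * I)))) s := by
  have h1 : HasDerivAt (fun t : ℝ => α + t * β) β s := by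
    simpa using ((hasDerivAt_id s).mul_const β).const_add α
  have h2 := (hasDerivAt_osc (α + s * β)).scomp s h1
  rw [Complex.real_smul] at h2
  exact h2

lemma hasLineDerivAt_ambFourier (H : UnimodularCoeff a b c e δ) (f h : 𝓢(Fin d → ℝ, ℂ))
    (p v : (Fin d → ℝ) × (Fin d → ℝ)) :
    HasLineDerivAt ℝ (ambFourier a b c e f h)
      (a * ambFourier a b c e (f.dirDeriv v.1) h p + c * ambFourier a b c e f (h.dirDeriv v.1) p +
        -(2 * π * I) * δ * (a * ambFourier a b c e f (h.linMul v.2) p -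
          c * ambFourier a b c e (f.linMul v.2) h p)) p v := by
  set D : (Fin d → ℝ) × (Fin d → ℝ) → (Fin d → ℝ) → ℂ := fun p y =>
    a * ambIntegrand a b c e (f.dirDeriv v.1) h p y +
      c * ambIntegrand a b c e f (h.dirDeriv v.1) p y +
        -(2 * π * I) * δ * (a * ambIntegrand a b c e f (h.linMul v.2) p y -
          c * ambIntegrand a b c e (f.linMul v.2) h p y) with hD
  have J := fun (f h : 𝓢(Fin d → ℝ, ℂ)) q => integrable_ambIntegrand H f h q
  have hDint : ∀ p, ∫ y, D p y = a * ambFourier a b c e (f.dirDeriv v.1) h p +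
      c * ambFourier a b c e f (h.dirDeriv v.1) p +
        -(2 * π * I) * δ * (a * ambFourier a b c e f (h.linMul v.2) p -
          c * ambFourier a b c e (f.linMul v.2) h p) := by
    intro p
    simp only [hD, ambFourier]
    have k1 : Integrable fun y => a * ambIntegrand a b c e (f.dirDeriv v.1) h p y +
        c * ambIntegrand a b c e f (h.dirDeriv v.1) p y :=
      ((J _ _ _).const_mul _).add ((J _ _ _).const_mul _)
    have k2 : Integrable fun y => (a * ambIntegrand a b c e f (h.linMul v.2) p y -
        c * ambIntegrand a b c e (f.linMul v.2) h p y : ℂ) :=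
      ((J _ _ _).const_mul _).sub ((J _ _ _).const_mul _)
    rw [integral_add k1 (k2.const_mul _), integral_add ((J _ _ _).const_mul _)
      ((J _ _ _).const_mul _), integral_const_mul,
      integral_const_mul, integral_const_mul, integral_sub ((J _ _ _).const_mul _)
      ((J _ _ _).const_mul _), integral_const_mul, integral_const_mul]
  have hbd : ∃ C : ℝ, ∀ p y, ‖D p y‖ ≤ C * decayWeight ((d + 1 : ℕ) : ℝ) y := by
    obtain ⟨C1, -, H1⟩ := exists_norm_ambIntegrand_le (f.dirDeriv v.1) h (d + 1)
    obtain ⟨C2, -, H2⟩ := exists_norm_ambIntegrand_le f (h.dirDeriv v.1) (d + 1)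
    obtain ⟨C3, -, H3⟩ := exists_norm_ambIntegrand_le f (h.linMul v.2) (d + 1)
    obtain ⟨C4, -, H4⟩ := exists_norm_ambIntegrand_le (f.linMul v.2) h (d + 1)
    refine ⟨‖(a : ℂ)‖ * C1 + ‖(c : ℂ)‖ * C2 + ‖(-(2 * π * I) * δ : ℂ)‖ *
      (‖(a : ℂ)‖ * C3 + ‖(c : ℂ)‖ * C4), fun p y => ?_⟩
    calc ‖D p y‖ ≤ ‖(a : ℂ)‖ * ‖ambIntegrand a b c e (f.dirDeriv v.1) h p y‖ +
          ‖(c : ℂ)‖ * ‖ambIntegrand a b c e f (h.dirDeriv v.1) p y‖ +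
          ‖(-(2 * π * I) * δ : ℂ)‖ * (‖(a : ℂ)‖ * ‖ambIntegrand a b c e f (h.linMul v.2) p y‖ +
          ‖(c : ℂ)‖ * ‖ambIntegrand a b c e (f.linMul v.2) h p y‖) := by
          simp only [hD, ← norm_mul]
          refine (norm_add_le _ _).trans (add_le_add (norm_add_le _ _) ?_)
          rw [norm_mul]
          exact mul_le_mul_of_nonneg_left (norm_sub_le _ _) (norm_nonneg _)
      _ ≤ ‖(a : ℂ)‖ * (C1 * decayWeight ((d + 1 : ℕ) : ℝ) y) +
          ‖(c : ℂ)‖ * (C2 * decayWeight ((d + 1 : ℕ) : ℝ) y) +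
          ‖(-(2 * π * I) * δ : ℂ)‖ * (‖(a : ℂ)‖ * (C3 * decayWeight ((d + 1 : ℕ) : ℝ) y) +
          ‖(c : ℂ)‖ * (C4 * decayWeight ((d + 1 : ℕ) : ℝ) y)) := by
          gcongr
          exacts [H1 H p y, H2 H p y, H3 H p y, H4 H p y]
      _ = _ := by ring
  obtain ⟨C, hC⟩ := hbd
  have hmeas : ∀ q, AEStronglyMeasurable (D q) volume := fun q =>
    ((((J _ _ _).const_mul _).add ((J _ _ _).const_mul _)).add
      ((((J _ _ _).const_mul _).sub ((J _ _ _).const_mul _)).const_mul _)).aestronglyMeasurable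
  have key := hasDerivAt_integral_of_dominated_loc_of_deriv_le (μ := (volume : Measure (Fin d → ℝ)))
    (F := fun (t : ℝ) y => ambIntegrand a b c e f h (p + t • v) y)
    (F' := fun (t : ℝ) y => D (p + t • v) y) (x₀ := 0)
    (bound := fun y => C * decayWeight ((d + 1 : ℕ) : ℝ) y) Filter.univ_mem
    (.of_forall fun t => (J _ _ _).aestronglyMeasurable) (J _ _ _) (hmeas _)
    (.of_forall fun y t _ => hC _ _) ((integrable_decayWeight_pi d).const_mul C)
    (.of_forall fun y t _ => ?_)
  · have := key.2
    simp only [hDint, zero_smul, add_zero] at this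
    exact this
  · have h1 := hasDerivAt_osc_affine (y ⬝ᵥ p.2) (y ⬝ᵥ v.2) t
    have h2 := f.hasDerivAt_comp (a • p.1 + b • y) v.1 a t
    have h3 := (h.hasDerivAt_comp (c • p.1 + e • y) v.1 c t).star
    refine (((h1.mul h2).mul h3).congr_deriv ?_).congr_of_eventuallyEq (.of_forall fun s => ?_)
    · have e1 : (a : ℂ) * e - b * c = δ := by exact_mod_cast congrArg ((↑) : ℝ → ℂ) H.det
      have e2 : (δ : ℂ) * δ = 1 := by exact_mod_cast congrArg ((↑) : ℝ → ℂ) H.sq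
      simp only [hD, ambIntegrand, Prod.fst_add, Prod.snd_add, Prod.smul_fst, Prod.smul_snd,
        Pi.mul_apply, dotProduct_add, dotProduct_smul, smul_eq_mul, SchwartzMap.linMul_apply,
        map_mul, conj_ofReal, ← starRingEnd_apply]
      rw [show a • (p.1 + t • v.1) + b • y = a • p.1 + b • y + (t * a) • v.1 by module,
        show c • (p.1 + t • v.1) + e • y = c • p.1 + e • y + (t * c) • v.1 by module]
      simp only [add_dotProduct, smul_dotProduct, smul_eq_mul]
      push_cast
      generalize osc _ = O
      generalize (starRingEnd ℂ) (h _) = G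
      generalize f _ = F
      linear_combination (2 * π * I * δ * ((y ⬝ᵥ v.2 : ℝ) : ℂ) * O * F * G) * e1 +
        (2 * π * I * ((y ⬝ᵥ v.2 : ℝ) : ℂ) * O * F * G) * e2
    · simp only [ambIntegrand, Prod.fst_add, Prod.snd_add, Prod.smul_fst, Prod.smul_snd,
        Pi.mul_apply, dotProduct_add, dotProduct_smul, smul_eq_mul, ← starRingEnd_apply]
      rw [show a • (p.1 + s • v.1) + b • y = a • p.1 + b • y + (s * a) • v.1 by module,
        show c • (p.1 + s • v.1) + e • y = c • p.1 + e • y + (s * c) • v.1 by module]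

lemma exists_dotProduct_fst_pow_mul_ambFourier_le (w : Fin d → ℝ) (n : ℕ) :
    ∀ f h : 𝓢(Fin d → ℝ, ℂ), ∃ C : ℝ, 0 ≤ C ∧ ∀ {a b c e δ : ℝ}, UnimodularCoeff a b c e δ →
      ∀ p, |p.1 ⬝ᵥ w| ^ n * ‖ambFourier a b c e f h p‖ ≤ C := by
  induction n with
  | zero => simpa using exists_norm_ambFourier_le
  | succ n ih =>
    intro f h
    obtain ⟨C1, h1, H1⟩ := ih (f.linMul w) h
    obtain ⟨C2, h2, H2⟩ := ih f (h.linMul w)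
    refine ⟨C1 + C2, by positivity, fun {a b c e δ} H p => ?_⟩
    have hδ : ‖(δ : ℂ)‖ = 1 := by
      have := congrArg (fun t : ℝ => ‖(t : ℂ)‖) H.sq
      simp only [ofReal_mul, norm_mul, ofReal_one, norm_one] at this
      nlinarith [norm_nonneg (δ : ℂ)]
    have he : ‖(e : ℂ)‖ ≤ 1 := by simpa using H.he
    have hb : ‖(b : ℂ)‖ ≤ 1 := by simpa using H.hb
    have key : |p.1 ⬝ᵥ w| * ‖ambFourier a b c e f h p‖ ≤
        ‖ambFourier a b c e (f.linMul w) h p‖ + ‖ambFourier a b c e f (h.linMul w) p‖ := by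
      rw [← Real.norm_eq_abs, ← Complex.norm_real, ← norm_mul, dotProduct_fst_mul_ambFourier H,
        norm_mul, hδ, one_mul]
      refine (norm_sub_le _ _).trans (add_le_add ?_ ?_) <;> rw [norm_mul]
      · exact mul_le_of_le_one_left (norm_nonneg _) he
      · exact mul_le_of_le_one_left (norm_nonneg _) hb
    calc |p.1 ⬝ᵥ w| ^ (n + 1) * ‖ambFourier a b c e f h p‖
        = |p.1 ⬝ᵥ w| ^ n * (|p.1 ⬝ᵥ w| * ‖ambFourier a b c e f h p‖) := by ring
      _ ≤ |p.1 ⬝ᵥ w| ^ n * (‖ambFourier a b c e (f.linMul w) h p‖ +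
          ‖ambFourier a b c e f (h.linMul w) p‖) := by gcongr
      _ ≤ C1 + C2 := by rw [mul_add]; exact add_le_add (H1 H p) (H2 H p)

lemma exists_dotProduct_snd_pow_mul_ambFourier_le (w : Fin d → ℝ) (n : ℕ) :
    ∀ f h : 𝓢(Fin d → ℝ, ℂ), ∃ C : ℝ, 0 ≤ C ∧ ∀ {a b c e δ : ℝ}, UnimodularCoeff a b c e δ →
      ∀ p, |w ⬝ᵥ p.2| ^ n * ‖ambFourier a b c e f h p‖ ≤ C := by
  induction n with
  | zero => simpa using exists_norm_ambFourier_le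
  | succ n ih =>
    intro f h
    obtain ⟨C1, h1, H1⟩ := ih (f.dirDeriv w) h
    obtain ⟨C2, h2, H2⟩ := ih f (h.dirDeriv w)
    refine ⟨C1 + C2, by positivity, fun {a b c e δ} H p => ?_⟩
    have he : ‖(e : ℂ)‖ ≤ 1 := by simpa using H.he
    have hb : ‖(b : ℂ)‖ ≤ 1 := by simpa using H.hb
    have hπ : 1 ≤ ‖(2 * π * I : ℂ)‖ := by
      simp only [norm_mul, norm_ofNat, norm_real, Real.norm_eq_abs, norm_I, mul_one,
        abs_of_pos Real.pi_pos]
      linarith [Real.pi_gt_three]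
    have key : |w ⬝ᵥ p.2| * ‖ambFourier a b c e f h p‖ ≤
        ‖ambFourier a b c e (f.dirDeriv w) h p‖ + ‖ambFourier a b c e f (h.dirDeriv w) p‖ := by
      calc |w ⬝ᵥ p.2| * ‖ambFourier a b c e f h p‖
          ≤ ‖(2 * π * I : ℂ)‖ * (|w ⬝ᵥ p.2| * ‖ambFourier a b c e f h p‖) :=
            le_mul_of_one_le_left (by positivity) hπ
        _ = ‖(2 * π * I) * ((w ⬝ᵥ p.2 : ℝ) : ℂ) * ambFourier a b c e f h p‖ := by
            rw [norm_mul _ (ambFourier _ _ _ _ _ _ _), norm_mul (2 * π * I : ℂ), norm_real,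
              Real.norm_eq_abs, mul_assoc (‖_‖) |_|]
        _ ≤ _ := by
            rw [dotProduct_snd_mul_ambFourier H]
            refine (norm_add_le _ _).trans (add_le_add ?_ ?_) <;> rw [norm_mul]
            · exact mul_le_of_le_one_left (norm_nonneg _) hb
            · exact mul_le_of_le_one_left (norm_nonneg _) he
    calc |w ⬝ᵥ p.2| ^ (n + 1) * ‖ambFourier a b c e f h p‖
        = |w ⬝ᵥ p.2| ^ n * (|w ⬝ᵥ p.2| * ‖ambFourier a b c e f h p‖) := by ring
      _ ≤ |w ⬝ᵥ p.2| ^ n * (‖ambFourier a b c e (f.dirDeriv w) h p‖ +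
          ‖ambFourier a b c e f (h.dirDeriv w) p‖) := by gcongr
      _ ≤ C1 + C2 := by rw [mul_add]; exact add_le_add (H1 H p) (H2 H p)

/-- Rapid decay of `ambFourier`, uniformly in the coefficients. -/
lemma exists_ambFourier_le_decayWeight (n : ℕ) (f h : 𝓢(Fin d → ℝ, ℂ)) : ∃ C : ℝ, 0 ≤ C ∧
    ∀ {a b c e δ : ℝ}, UnimodularCoeff a b c e δ →
      ∀ p, ‖ambFourier a b c e f h p‖ ≤ C * decayWeight n p := by
  obtain ⟨C0, h0, H0⟩ := exists_norm_ambFourier_le f h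
  choose C1 h1 H1 using fun i : Fin d =>
    exists_dotProduct_fst_pow_mul_ambFourier_le (Pi.single i 1) n f h
  choose C2 h2 H2 using fun i : Fin d =>
    exists_dotProduct_snd_pow_mul_ambFourier_le (Pi.single i 1) n f h
  have s1 : 0 ≤ ∑ i, C1 i := Finset.sum_nonneg fun i _ => h1 i
  have s2 : 0 ≤ ∑ i, C2 i := Finset.sum_nonneg fun i _ => h2 i
  refine ⟨2 ^ n * (C0 + ∑ i, C1 i + ∑ i, C2 i), by positivity, fun H p =>
    le_decayWeight_of_coord (norm_nonneg _) ?_ (fun i => ?_) fun i => ?_⟩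
  · linarith [H0 H p]
  · have := H1 i H p
    rw [dotProduct_single, mul_one] at this
    linarith [Finset.single_le_sum (fun i _ => h1 i) (Finset.mem_univ i)]
  · have := H2 i H p
    rw [single_dotProduct, one_mul] at this
    linarith [Finset.single_le_sum (fun i _ => h2 i) (Finset.mem_univ i)]

end Amb

end Oscillation

section AmbRegularity

open scoped ContDiff SchwartzMap

variable {a b c e δ : ℝ}

lemma continuous_ambFourier (H : UnimodularCoeff a b c e δ) (f h : 𝓢(Fin d → ℝ, ℂ)) :
    Continuous (ambFourier a b c e f h) := by
  obtain ⟨C, -, hC⟩ := exists_norm_ambIntegrand_le f h (d + 1)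
  refine continuous_of_dominated (fun p => (integrable_ambIntegrand H f h p).aestronglyMeasurable)
    (fun p => .of_forall fun y => hC H p y) ((integrable_decayWeight_pi d).const_mul C)
    (.of_forall fun y => ?_)
  unfold ambIntegrand
  have := f.continuous
  have := h.continuous
  fun_prop

lemma stronglyMeasurable_ambFourier_coeff (f h : 𝓢(Fin d → ℝ, ℂ)) :
    StronglyMeasurable fun q : ℝ × ((Fin d → ℝ) × (Fin d → ℝ)) =>
      ambFourier 1 q.1 1 (-(1 - q.1)) f h q.2 := by
  have hc : Continuous fun u : (ℝ × ((Fin d → ℝ) × (Fin d → ℝ))) × (Fin d → ℝ) =>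
      ambIntegrand 1 u.1.1 1 (-(1 - u.1.1)) f h u.1.2 u.2 := by
    unfold ambIntegrand
    have := f.continuous
    have := h.continuous
    fun_prop
  exact hc.stronglyMeasurable.integral_prod_right'

/-- Smooth functions all of whose iterated derivatives in the direction `v` are `O(⟨·⟩^m)`. -/
def DirSymbol (m : ℝ) (v : (Fin d → ℝ) × (Fin d → ℝ)) (s : (Fin d → ℝ) × (Fin d → ℝ) → ℂ) :
    Prop :=
  ContDiff ℝ ∞ s ∧ ∀ k : ℕ, ∃ C : ℝ, ∀ z, ‖(pdir v)^[k] s z‖ ≤ C * jb2 z ^ m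

variable {m : ℝ} {v : (Fin d → ℝ) × (Fin d → ℝ)} {s : (Fin d → ℝ) × (Fin d → ℝ) → ℂ}

lemma DirSymbol.pdir (hs : DirSymbol m v s) : DirSymbol m v (pdir v s) :=
  ⟨(hs.1.fderiv_right (m := ∞) le_rfl).clm_apply contDiff_const, fun k => hs.2 (k + 1)⟩

lemma DirSymbol.continuous (hs : DirSymbol m v s) : Continuous s := hs.1.continuous

lemma DirSymbol.exists_norm_le (hs : DirSymbol m v s) :
    ∃ C : ℝ, 0 ≤ C ∧ ∀ z, ‖s z‖ ≤ C * jb2 z ^ m := by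
  obtain ⟨C, hC⟩ := hs.2 0
  refine ⟨|C|, abs_nonneg C, fun z => (hC z).trans ?_⟩
  exact mul_le_mul_of_nonneg_right (le_abs_self C) (Real.rpow_nonneg (jb2_pos z).le _)

lemma mpdList_replicate (k : ℕ) (v : (Fin d → ℝ) × (Fin d → ℝ)) :
    mpdList (List.replicate k v) s = (_root_.pdir v)^[k] s := by
  induction k with
  | zero => rfl
  | succ k ih =>
    rw [List.replicate_succ, Function.iterate_succ_apply', ← ih]
    rfl

lemma stdList_single (i : Fin d) (k : ℕ) :
    stdList d (Pi.single i k) = List.replicate k (Pi.single i 1) := by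
  unfold stdList
  have key : ∀ l : List (Fin d), l.Nodup →
      (l.flatMap fun j => List.replicate ((Pi.single i k : Fin d → ℕ) j)
        (Pi.single j 1 : Fin d → ℝ)) =
      if i ∈ l then List.replicate k (Pi.single i 1) else [] := by
    intro l
    induction l with
    | nil => simp
    | cons j l ih =>
      intro hl
      rw [List.nodup_cons] at hl
      rw [List.flatMap_cons, ih hl.2]
      by_cases hij : j = i
      · subst hij; simp [hl.1]
      · simp [hij, Ne.symm hij]
  rw [key _ (List.nodup_finRange d), if_pos (List.mem_finRange i)]

lemma stdList_zero : stdList d 0 = [] := by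
  simp [stdList]

lemma SmSymbol.dirSymbol_fst (hs : SmSymbol d m s) (i : Fin d) :
    DirSymbol m (Pi.single i 1, 0) s := by
  refine ⟨hs.1, fun k => ?_⟩
  have := hs.2 (Pi.single i k, 0)
  simpa [mpd2, stdList2, stdList_single, stdList_zero, mpdList_replicate] using this

lemma SmSymbol.dirSymbol_snd (hs : SmSymbol d m s) (i : Fin d) :
    DirSymbol m (0, Pi.single i 1) s := by
  refine ⟨hs.1, fun k => ?_⟩
  have := hs.2 (0, Pi.single i k)
  simpa [mpd2, stdList2, stdList_single, stdList_zero, mpdList_replicate] using this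

lemma SmSymbol.dirSymbol_zero (hs : SmSymbol d m s) : DirSymbol m 0 s := by
  refine ⟨hs.1, fun k => ?_⟩
  cases k with
  | zero => simpa [mpd2, stdList2, stdList_zero, mpdList] using hs.2 (0, 0)
  | succ k =>
    refine ⟨0, fun z => ?_⟩
    rw [Function.iterate_succ_apply']
    simp [_root_.pdir]

/-- The duality pairing on phase space. -/
def phasePair (ζ p : (Fin d → ℝ) × (Fin d → ℝ)) : ℝ := ζ.1 ⬝ᵥ p.1 + ζ.2 ⬝ᵥ p.2

lemma phasePair_add_smul (ζ p v : (Fin d → ℝ) × (Fin d → ℝ)) (t : ℝ) :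
    phasePair ζ (p + t • v) = phasePair ζ p + t * phasePair ζ v := by
  simp [phasePair, dotProduct_add, dotProduct_smul]; ring

@[fun_prop]
lemma continuous_phasePair (ζ : (Fin d → ℝ) × (Fin d → ℝ)) : Continuous (phasePair ζ) := by
  unfold phasePair; fun_prop

/-- Oscillatory integral of a symbol against a translated `ambFourier`. -/
def oscInt (s : (Fin d → ℝ) × (Fin d → ℝ) → ℂ) (A : (Fin d → ℝ) × (Fin d → ℝ) → ℂ)
    (T ζ : (Fin d → ℝ) × (Fin d → ℝ)) : ℂ :=
  ∫ p, osc (phasePair ζ p) * (s p * (starRingEnd ℂ) (A (p - T)))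

/-- A symbol times a translated `ambFourier` is dominated by an integrable translate. -/
lemma DirSymbol.exists_norm_mul_le (hs : DirSymbol m v s) (f h : 𝓢(Fin d → ℝ, ℂ)) :
    ∃ C : ℝ, 0 ≤ C ∧ ∀ {a b c e δ : ℝ}, UnimodularCoeff a b c e δ → ∀ T ζ p,
      ‖osc (phasePair ζ p) * (s p * (starRingEnd ℂ) (ambFourier a b c e f h (p - T)))‖ ≤
        C * jb2 T ^ m * decayWeight ((2 * d + 1 : ℕ) : ℝ) (p - T) := by
  obtain ⟨C1, h1, H1⟩ := hs.exists_norm_le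
  obtain ⟨C2, h2, H2⟩ := exists_jb2_rpow_le d m
  obtain ⟨n, hn⟩ := exists_nat_ge |m|
  obtain ⟨C3, h3, H3⟩ := exists_ambFourier_le_decayWeight (n + (2 * d + 1)) f h
  refine ⟨C1 * C2 * C3, by positivity, fun H T ζ p => ?_⟩
  have hT := Real.rpow_nonneg (jb2_pos T).le m
  have e1 : ‖s p‖ ≤ C1 * (C2 * jb2 T ^ m * decayWeight (-|m|) (p - T)) :=
    (H1 p).trans (mul_le_mul_of_nonneg_left (H2 p T) h1)
  have e2 : decayWeight (-|m|) (p - T) * decayWeight ((n + (2 * d + 1) : ℕ) : ℝ) (p - T) ≤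
      decayWeight ((2 * d + 1 : ℕ) : ℝ) (p - T) := by
    rw [← decayWeight_add]
    apply decayWeight_anti
    push_cast
    linarith
  rw [norm_mul, norm_mul, norm_osc, one_mul, RCLike.norm_conj]
  calc _ ≤ C1 * (C2 * jb2 T ^ m * decayWeight (-|m|) (p - T)) *
        (C3 * decayWeight ((n + (2 * d + 1) : ℕ) : ℝ) (p - T)) :=
        mul_le_mul e1 (H3 H _) (norm_nonneg _) (mul_nonneg h1 (mul_nonneg (mul_nonneg h2.le hT)
          (decayWeight_nonneg _ _)))
    _ = C1 * C2 * C3 * jb2 T ^ m * (decayWeight (-|m|) (p - T) *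
        decayWeight ((n + (2 * d + 1) : ℕ) : ℝ) (p - T)) := by ring
    _ ≤ _ := mul_le_mul_of_nonneg_left e2 (by positivity)

lemma DirSymbol.integrable_osc_mul (hs : DirSymbol m v s) (H : UnimodularCoeff a b c e δ)
    (f h : 𝓢(Fin d → ℝ, ℂ)) (T ζ : (Fin d → ℝ) × (Fin d → ℝ)) :
    Integrable fun p =>
      osc (phasePair ζ p) * (s p * (starRingEnd ℂ) (ambFourier a b c e f h (p - T))) := by
  obtain ⟨C, -, hC⟩ := hs.exists_norm_mul_le f h
  refine (((integrable_decayWeight_phase d).comp_sub_right T).const_mul (C * jb2 T ^ m)).mono' ?_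
    (.of_forall fun p => hC H T ζ p)
  have := hs.continuous
  have := continuous_ambFourier H f h
  exact Continuous.aestronglyMeasurable (by fun_prop)

lemma DirSymbol.exists_norm_oscInt_le (hs : DirSymbol m v s) (f h : 𝓢(Fin d → ℝ, ℂ)) :
    ∃ C : ℝ, 0 ≤ C ∧ ∀ {a b c e δ : ℝ}, UnimodularCoeff a b c e δ → ∀ T ζ,
      ‖oscInt s (ambFourier a b c e f h) T ζ‖ ≤ C * jb2 T ^ m := by
  obtain ⟨C, h0, hC⟩ := hs.exists_norm_mul_le f h
  have hI := integrable_decayWeight_phase d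
  refine ⟨C * ∫ p, decayWeight ((2 * d + 1 : ℕ) : ℝ) (p : (Fin d → ℝ) × (Fin d → ℝ)),
    mul_nonneg h0 (integral_nonneg fun _ => decayWeight_nonneg _ _), fun H T ζ => ?_⟩
  refine (norm_integral_le_of_norm_le ((hI.comp_sub_right T).const_mul (C * jb2 T ^ m))
    (.of_forall fun p => hC H T ζ p)).trans_eq ?_
  rw [integral_const_mul, integral_sub_right_eq_self
    (fun p : (Fin d → ℝ) × (Fin d → ℝ) => decayWeight ((2 * d + 1 : ℕ) : ℝ) p) T]
  ring

lemma oscInt_eq_of_lineDeriv (hs : DirSymbol m v s) (H : UnimodularCoeff a b c e δ)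
    (f h : 𝓢(Fin d → ℝ, ℂ)) (T ζ : (Fin d → ℝ) × (Fin d → ℝ)) :
    (2 * π * I) * (phasePair ζ v : ℂ) * oscInt s (ambFourier a b c e f h) T ζ =
      oscInt (_root_.pdir v s) (ambFourier a b c e f h) T ζ +
      (a * oscInt s (ambFourier a b c e (f.dirDeriv v.1) h) T ζ +
        c * oscInt s (ambFourier a b c e f (h.dirDeriv v.1)) T ζ +
        (2 * π * I) * δ * (a * oscInt s (ambFourier a b c e f (h.linMul v.2)) T ζ -
          c * oscInt s (ambFourier a b c e (f.linMul v.2) h) T ζ)) := by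
  set A := ambFourier a b c e f h with hA
  set A1 := ambFourier a b c e (f.dirDeriv v.1) h with hA1
  set A2 := ambFourier a b c e f (h.dirDeriv v.1) with hA2
  set A3 := ambFourier a b c e f (h.linMul v.2) with hA3
  set A4 := ambFourier a b c e (f.linMul v.2) h with hA4
  have J0 := hs.integrable_osc_mul H f h T ζ
  have J0' := hs.pdir.integrable_osc_mul H f h T ζ
  have J1 := (hs.integrable_osc_mul H (f.dirDeriv v.1) h T ζ).const_mul (a : ℂ)
  have J2 := (hs.integrable_osc_mul H f (h.dirDeriv v.1) T ζ).const_mul (c : ℂ)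
  have J3 := (hs.integrable_osc_mul H f (h.linMul v.2) T ζ).const_mul (a : ℂ)
  have J4 := (hs.integrable_osc_mul H (f.linMul v.2) h T ζ).const_mul (c : ℂ)
  have J12 := J1.add J2
  have J34 := (J3.sub J4).const_mul ((2 * π * I) * δ)
  have Jall := J0'.add (J12.add J34)
  set B' : (Fin d → ℝ) × (Fin d → ℝ) → ℂ := fun p =>
    _root_.pdir v s p * (starRingEnd ℂ) (A (p - T)) +
    s p * (starRingEnd ℂ) (a * A1 (p - T) + c * A2 (p - T) +
        -(2 * π * I) * δ * (a * A3 (p - T) - c * A4 (p - T))) with hB'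
  have e2 : ∀ p, osc (phasePair ζ p) * B' p =
      osc (phasePair ζ p) * (_root_.pdir v s p * (starRingEnd ℂ) (A (p - T))) +
      ((a * (osc (phasePair ζ p) * (s p * (starRingEnd ℂ) (A1 (p - T)))) +
        c * (osc (phasePair ζ p) * (s p * (starRingEnd ℂ) (A2 (p - T))))) +
        (2 * π * I) * δ * (a * (osc (phasePair ζ p) * (s p * (starRingEnd ℂ) (A3 (p - T)))) -
          c * (osc (phasePair ζ p) * (s p * (starRingEnd ℂ) (A4 (p - T)))))) := fun p => by
    simp only [hB', map_add, map_mul, map_sub, map_neg, conj_ofReal, conj_I, map_ofNat]; ring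
  have ibp := integral_bilinear_hasLineDerivAt_right_eq_neg_left_of_integrable
    (μ := (volume : Measure ((Fin d → ℝ) × (Fin d → ℝ)))) (B := ContinuousLinearMap.mul ℝ ℂ)
    (v := v) (f := fun p => osc (phasePair ζ p))
    (f' := fun p => -(2 * π * I) * (phasePair ζ v : ℂ) * osc (phasePair ζ p))
    (g := fun p => s p * (starRingEnd ℂ) (A (p - T))) (g' := B') ?_ ?_ ?_ ?_ ?_
  · simp only [ContinuousLinearMap.mul_apply', mul_assoc _ (osc _)] at ibp
    rw [integral_const_mul, integral_congr_ae (.of_forall e2)] at ibp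
    have k1 := integral_add J0' (J12.add J34)
    have k2 := integral_add J12 J34
    have k3 := integral_add J1 J2
    have k4 := integral_sub J3 J4
    simp only [Pi.add_apply, Pi.sub_apply, integral_const_mul] at k1 k2 k3 k4
    rw [k1, k2, k3, k4] at ibp
    unfold oscInt
    linear_combination -ibp
  · simp only [ContinuousLinearMap.mul_apply', mul_assoc _ (osc _)]
    exact J0.const_mul _
  · simp only [ContinuousLinearMap.mul_apply', e2]
    exact Jall
  · simp only [ContinuousLinearMap.mul_apply']
    exact J0
  · intro p _
    have h1 : HasDerivAt (fun t : ℝ => phasePair ζ (p + t • v)) (phasePair ζ v) 0 := by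
      simp only [phasePair_add_smul]
      simpa using ((hasDerivAt_id (0 : ℝ)).mul_const (phasePair ζ v)).const_add (phasePair ζ p)
    have h2 := (hasDerivAt_osc _).scomp (0 : ℝ) h1
    refine h2.congr_deriv ?_
    rw [Complex.real_smul]; simp; ring
  · intro p _
    have h1 : HasLineDerivAt ℝ s (_root_.pdir v s p) p v :=
      ((hs.1.differentiable (by simp)) p).hasFDerivAt.hasLineDerivAt v
    have h2 : HasLineDerivAt ℝ A _ (p - T) v := hasLineDerivAt_ambFourier H f h (p - T) v
    have h3 := HasDerivAt.mul h1 (HasDerivAt.star h2)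
    refine (h3.congr_deriv ?_).congr_of_eventuallyEq (.of_forall fun t => ?_)
    · simp only [hB', zero_smul, add_zero, ← starRingEnd_apply]
      rfl
    · simp only [Pi.mul_apply, ← starRingEnd_apply, sub_add_eq_add_sub]

lemma exists_phasePair_pow_mul_oscInt_le (n : ℕ) :
    ∀ {s : (Fin d → ℝ) × (Fin d → ℝ) → ℂ}, DirSymbol m v s → ∀ f h : 𝓢(Fin d → ℝ, ℂ),
    ∃ C : ℝ, 0 ≤ C ∧ ∀ {a b c e δ : ℝ}, UnimodularCoeff a b c e δ → ∀ T ζ,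
      |phasePair ζ v| ^ n * ‖oscInt s (ambFourier a b c e f h) T ζ‖ ≤ C * jb2 T ^ m := by
  induction n with
  | zero =>
    intro s hs f h
    simp only [pow_zero, one_mul]
    exact hs.exists_norm_oscInt_le f h
  | succ n ih =>
    intro s hs f h
    obtain ⟨C0, h0, H0⟩ := ih hs.pdir f h
    obtain ⟨C1, h1, H1⟩ := ih hs (f.dirDeriv v.1) h
    obtain ⟨C2, h2, H2⟩ := ih hs f (h.dirDeriv v.1)
    obtain ⟨C3, h3, H3⟩ := ih hs f (h.linMul v.2)
    obtain ⟨C4, h4, H4⟩ := ih hs (f.linMul v.2) h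
    refine ⟨C0 + C1 + C2 + C3 + C4, by positivity, fun {a b c e δ} H T ζ => ?_⟩
    have hδ : ‖(δ : ℂ)‖ = 1 := by
      have := congrArg (fun t : ℝ => ‖(t : ℂ)‖) H.sq
      simp only [ofReal_mul, norm_mul, ofReal_one, norm_one] at this
      nlinarith [norm_nonneg (δ : ℂ)]
    have ha : ‖(a : ℂ)‖ ≤ 1 := by simpa using H.ha
    have hc : ‖(c : ℂ)‖ ≤ 1 := by simpa using H.hc
    have hπ : 1 ≤ ‖(2 * π * I : ℂ)‖ := by
      simp only [norm_mul, norm_ofNat, norm_real, Real.norm_eq_abs, norm_I, mul_one,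
        abs_of_pos Real.pi_pos]
      linarith [Real.pi_gt_three]
    have key := congrArg norm (oscInt_eq_of_lineDeriv hs H f h T ζ)
    have H0 := H0 H T ζ
    have H1 := H1 H T ζ
    have H2 := H2 H T ζ
    have H3 := H3 H T ζ
    have H4 := H4 H T ζ
    generalize oscInt s (ambFourier a b c e f h) T ζ = X at *
    generalize oscInt (_root_.pdir v s) (ambFourier a b c e f h) T ζ = Y0 at *
    generalize oscInt s (ambFourier a b c e (f.dirDeriv v.1) h) T ζ = Y1 at *
    generalize oscInt s (ambFourier a b c e f (h.dirDeriv v.1)) T ζ = Y2 at *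
    generalize oscInt s (ambFourier a b c e f (h.linMul v.2)) T ζ = Y3 at *
    generalize oscInt s (ambFourier a b c e (f.linMul v.2) h) T ζ = Y4 at *
    generalize hP : ‖(2 * π * I : ℂ)‖ = P at *
    have key2 : |phasePair ζ v| * ‖X‖ ≤ ‖Y0‖ + ‖Y1‖ + ‖Y2‖ + ‖Y3‖ + ‖Y4‖ := by
      have hP0 : 0 < P := by linarith
      rw [norm_mul, norm_mul (2 * π * I : ℂ), hP, norm_real, Real.norm_eq_abs] at key
      have t34 : ‖(2 * π * I) * δ * (a * Y3 - c * Y4)‖ ≤ P * (‖Y3‖ + ‖Y4‖) := by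
        rw [norm_mul, norm_mul (2 * π * I : ℂ), hP, hδ, mul_one]
        refine mul_le_mul_of_nonneg_left ((norm_sub_le _ _).trans (add_le_add ?_ ?_)) hP0.le <;>
          rw [norm_mul]
        · exact mul_le_of_le_one_left (norm_nonneg _) ha
        · exact mul_le_of_le_one_left (norm_nonneg _) hc
      have t1 : ‖(a : ℂ) * Y1‖ ≤ ‖Y1‖ := by
        rw [norm_mul]; exact mul_le_of_le_one_left (norm_nonneg _) ha
      have t2 : ‖(c : ℂ) * Y2‖ ≤ ‖Y2‖ := by
        rw [norm_mul]; exact mul_le_of_le_one_left (norm_nonneg _) hc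
      have t : P * |phasePair ζ v| * ‖X‖ ≤ ‖Y0‖ + (‖Y1‖ + ‖Y2‖ + P * (‖Y3‖ + ‖Y4‖)) := by
        rw [key]
        exact (norm_add_le _ _).trans (add_le_add le_rfl ((norm_add_le _ _).trans
          (add_le_add ((norm_add_le _ _).trans (add_le_add t1 t2)) t34)))
      have t' : P * (|phasePair ζ v| * ‖X‖) ≤ P * (‖Y0‖ + ‖Y1‖ + ‖Y2‖ + ‖Y3‖ + ‖Y4‖) := by
        nlinarith [norm_nonneg Y0, norm_nonneg Y1, norm_nonneg Y2]
      exact le_of_mul_le_mul_left t' hP0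
    calc |phasePair ζ v| ^ (n + 1) * ‖X‖ = |phasePair ζ v| ^ n * (|phasePair ζ v| * ‖X‖) := by ring
      _ ≤ |phasePair ζ v| ^ n * (‖Y0‖ + ‖Y1‖ + ‖Y2‖ + ‖Y3‖ + ‖Y4‖) := by gcongr
      _ ≤ _ := by linarith

/-- Decay of the oscillatory integral in the frequency variable, uniformly in the coefficients. -/
lemma SmSymbol.exists_norm_oscInt_le (hs : SmSymbol d m s) (n : ℕ) (f h : 𝓢(Fin d → ℝ, ℂ)) :
    ∃ C : ℝ, 0 ≤ C ∧ ∀ {a b c e δ : ℝ}, UnimodularCoeff a b c e δ → ∀ T ζ,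
      ‖oscInt s (ambFourier a b c e f h) T ζ‖ ≤ C * jb2 T ^ m * decayWeight n ζ := by
  obtain ⟨C0, h0, H0⟩ := hs.dirSymbol_zero.exists_norm_oscInt_le f h
  choose C1 h1 H1 using fun i : Fin d =>
    exists_phasePair_pow_mul_oscInt_le n (hs.dirSymbol_fst i) f h
  choose C2 h2 H2 using fun i : Fin d =>
    exists_phasePair_pow_mul_oscInt_le n (hs.dirSymbol_snd i) f h
  have s1 : 0 ≤ ∑ i, C1 i := Finset.sum_nonneg fun i _ => h1 i
  have s2 : 0 ≤ ∑ i, C2 i := Finset.sum_nonneg fun i _ => h2 i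
  refine ⟨2 ^ n * (C0 + ∑ i, C1 i + ∑ i, C2 i), by positivity, fun H T ζ => ?_⟩
  have hT := Real.rpow_nonneg (jb2_pos T).le m
  rw [mul_assoc (2 ^ n)]
  refine le_decayWeight_of_coord (norm_nonneg _) ((H0 H T ζ).trans ?_) (fun i => ?_) fun i => ?_
  · exact mul_le_mul_of_nonneg_right (by linarith) hT
  · have := H1 i H T ζ
    simp only [phasePair, dotProduct_single, mul_one, dotProduct_zero, add_zero] at this
    exact this.trans (mul_le_mul_of_nonneg_right
      (by linarith [Finset.single_le_sum (fun i _ => h1 i) (Finset.mem_univ i)]) hT)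
  · have := H2 i H T ζ
    simp only [phasePair, dotProduct_single, mul_one, dotProduct_zero, zero_add] at this
    exact this.trans (mul_le_mul_of_nonneg_right
      (by linarith [Finset.single_le_sum (fun i _ => h2 i) (Finset.mem_univ i)]) hT)

end AmbRegularity

section TimeFrequency

open scoped SchwartzMap FourierTransform

lemma unimodularCoeff_stft : UnimodularCoeff 0 1 (-1) 1 1 := by
  constructor <;> norm_num

lemma unimodularCoeff_wig {τ : ℝ} (h0 : 0 ≤ τ) (h1 : τ ≤ 1) :
    UnimodularCoeff 1 τ 1 (-(1 - τ)) (-1) := by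
  constructor
  · norm_num
  · exact abs_le.2 ⟨by linarith, h1⟩
  · norm_num
  · exact abs_le.2 ⟨by linarith, by linarith⟩
  · ring
  · norm_num

lemma stft_eq_ambFourier (g f : (Fin d → ℝ) → ℂ) (x ω : Fin d → ℝ) :
    stft g f x ω = ambFourier 0 1 (-1) 1 f g (x, ω) := by
  unfold stft ambFourier
  refine integral_congr_ae (.of_forall fun y => ?_)
  simp only [ambIntegrand, osc, dotProduct, zero_smul, one_smul, zero_add, neg_smul]
  rw [neg_add_eq_sub]
  push_cast
  simp only [mul_comm]

lemma stft_eq_integral_osc (g f : (Fin d → ℝ) → ℂ) (x ω : Fin d → ℝ) :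
    stft g f x ω = ∫ y, osc (y ⬝ᵥ ω) * (f y * (starRingEnd ℂ) (g (y - x))) := by
  rw [stft_eq_ambFourier]
  refine integral_congr_ae (.of_forall fun y => ?_)
  simp only [ambIntegrand, zero_smul, one_smul, zero_add, neg_smul, neg_add_eq_sub, mul_assoc]

lemma wig_eq_ambFourier (τ : ℝ) (f h : (Fin d → ℝ) → ℂ) (p : (Fin d → ℝ) × (Fin d → ℝ)) :
    wig τ f h p = ambFourier 1 τ 1 (-(1 - τ)) f h p := by
  unfold wig ambFourier
  refine integral_congr_ae (.of_forall fun y => ?_)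
  simp only [ambIntegrand, osc, dotProduct, one_smul, neg_smul, ← sub_eq_add_neg]

lemma tshift_eq (w : (Fin d → ℝ) × (Fin d → ℝ)) (g : (Fin d → ℝ) → ℂ) (t : Fin d → ℝ) :
    tshift w g t = osc (-(t ⬝ᵥ w.2)) * g (t - w.1) := by
  simp only [tshift, osc, dotProduct]
  push_cast
  simp only [mul_neg, neg_neg, mul_comm]

lemma norm_tshift (w : (Fin d → ℝ) × (Fin d → ℝ)) (g : (Fin d → ℝ) → ℂ) (t : Fin d → ℝ) :
    ‖tshift w g t‖ = ‖g (t - w.1)‖ := by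
  rw [tshift_eq, norm_mul, norm_osc, one_mul]

/-- The phase-space centre of the cross-τ-Wigner distribution of two time-frequency shifts. -/
def wigCentre (τ : ℝ) (z w : (Fin d → ℝ) × (Fin d → ℝ)) : (Fin d → ℝ) × (Fin d → ℝ) :=
  ((1 - τ) • z.1 + τ • w.1, τ • z.2 + (1 - τ) • w.2)

lemma wig_tshift (τ : ℝ) (g : (Fin d → ℝ) → ℂ) (z w p : (Fin d → ℝ) × (Fin d → ℝ)) :
    wig τ (tshift z g) (tshift w g) p =
      osc ((z.1 - w.1) ⬝ᵥ (p.2 - (wigCentre τ z w).2) - p.1 ⬝ᵥ (z.2 - w.2)) *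
        ambFourier 1 τ 1 (-(1 - τ)) g g (p - wigCentre τ z w) := by
  rw [wig_eq_ambFourier]
  unfold ambFourier
  rw [← integral_add_right_eq_self _ (z.1 - w.1), ← integral_const_mul]
  refine integral_congr_ae (.of_forall fun y => ?_)
  simp only [ambIntegrand, tshift_eq, map_mul, conj_osc]
  rw [show (1 : ℝ) • p.1 + τ • (y + (z.1 - w.1)) - z.1 =
      (1 : ℝ) • (p - wigCentre τ z w).1 + τ • y by
      simp only [wigCentre, Prod.fst_sub]; module,
    show (1 : ℝ) • p.1 + -(1 - τ) • (y + (z.1 - w.1)) - w.1 =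
      (1 : ℝ) • (p - wigCentre τ z w).1 + -(1 - τ) • y by
      simp only [wigCentre, Prod.fst_sub]; module]
  have key : osc ((y + (z.1 - w.1)) ⬝ᵥ p.2) *
      osc (-(((1 : ℝ) • p.1 + τ • (y + (z.1 - w.1))) ⬝ᵥ z.2)) *
      osc (- -(((1 : ℝ) • p.1 + -(1 - τ) • (y + (z.1 - w.1))) ⬝ᵥ w.2)) =
      osc ((z.1 - w.1) ⬝ᵥ (p.2 - (wigCentre τ z w).2) - p.1 ⬝ᵥ (z.2 - w.2)) *
        osc (y ⬝ᵥ (p - wigCentre τ z w).2) := by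
    rw [← osc_add, ← osc_add, ← osc_add]
    congr 1
    simp only [wigCentre, Prod.snd_sub, add_dotProduct, smul_dotProduct, dotProduct_sub,
      dotProduct_add, dotProduct_smul, sub_dotProduct, smul_eq_mul]
    ring
  linear_combination (g ((1 : ℝ) • (p - wigCentre τ z w).1 + τ • y) *
    (starRingEnd ℂ) (g ((1 : ℝ) • (p - wigCentre τ z w).1 + -(1 - τ) • y))) * key

lemma norm_stft_tshift (g : (Fin d → ℝ) → ℂ) (z w : (Fin d → ℝ) × (Fin d → ℝ)) :
    ‖stft g (tshift w g) z.1 z.2‖ = ‖stft g g (z - w).1 (z - w).2‖ := by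
  rw [stft_eq_integral_osc, stft_eq_integral_osc, ← integral_add_right_eq_self _ w.1]
  have key : ∀ y, osc ((y + w.1) ⬝ᵥ z.2) *
      (tshift w g (y + w.1) * (starRingEnd ℂ) (g (y + w.1 - z.1))) =
      osc (w.1 ⬝ᵥ (z.2 - w.2)) * (osc (y ⬝ᵥ (z - w).2) *
        (g y * (starRingEnd ℂ) (g (y - (z - w).1)))) := by
    intro y
    rw [tshift_eq, add_sub_cancel_right, Prod.fst_sub, show y + w.1 - z.1 = y - (z.1 - w.1) by abel]
    have : osc ((y + w.1) ⬝ᵥ z.2) * osc (-((y + w.1) ⬝ᵥ w.2)) =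
        osc (w.1 ⬝ᵥ (z.2 - w.2)) * osc (y ⬝ᵥ (z - w).2) := by
      rw [← osc_add, ← osc_add]
      congr 1
      simp only [Prod.snd_sub, add_dotProduct, dotProduct_sub]
      ring
    linear_combination (g y * (starRingEnd ℂ) (g (y - (z.1 - w.1)))) * this
  simp only [key]
  rw [integral_const_mul, norm_mul, norm_osc, one_mul]

/-- Fourier inversion on `Fin d → ℝ`. -/
lemma integral_osc_fourier_inversion {s : (Fin d → ℝ) → ℂ} (hc : Continuous s) (hs : Integrable s)
    (hF : Integrable fun ω : Fin d → ℝ => ∫ y, osc (y ⬝ᵥ ω) * s y) (t : Fin d → ℝ) :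
    ∫ ω : Fin d → ℝ, osc (-(t ⬝ᵥ ω)) * ∫ y, osc (y ⬝ᵥ ω) * s y = s t := by
  have hm := PiLp.volume_preserving_ofLp (Fin d)
  have he := (MeasurableEquiv.toLp 2 (Fin d → ℝ)).symm.measurableEmbedding
  set s' : EuclideanSpace ℝ (Fin d) → ℂ := fun y => s y.ofLp with hs'
  have e1 : ∀ w : EuclideanSpace ℝ (Fin d), 𝓕 s' w = ∫ y, osc (y ⬝ᵥ w.ofLp) * s y := by
    intro w
    rw [Real.fourier_eq', ← hm.integral_comp he]
    refine integral_congr_ae (.of_forall fun y => ?_)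
    simp only [smul_eq_mul, osc, hs']
    congr 2
    rw [EuclideanSpace.inner_eq_star_dotProduct, dotProduct_comm]
    simp
    ring
  have h1 : Integrable s' := hm.integrable_comp_of_integrable hs
  have h2 : Integrable (𝓕 s') := by
    rw [show 𝓕 s' = fun w => ∫ y, osc (y ⬝ᵥ w.ofLp) * s y from funext e1]
    exact hm.integrable_comp_of_integrable hF
  have h3 : Continuous s' := hc.comp (PiLp.continuous_ofLp 2 _)
  have h4 := congrFun (h3.fourierInv_fourier_eq h1 h2) (WithLp.toLp 2 t)
  rw [Real.fourierInv_eq'] at h4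
  rw [← hm.integral_comp he]
  rw [show s t = s' (WithLp.toLp 2 t) from rfl, ← h4]
  refine integral_congr_ae (.of_forall fun w => ?_)
  simp only [smul_eq_mul, e1, osc]
  congr 2
  rw [EuclideanSpace.inner_eq_star_dotProduct]
  simp
  ring

end TimeFrequency

section Reproducing

open scoped SchwartzMap

lemma decayWeight_neg_add_le {E : Type*} [NormedAddCommGroup E] {N : ℝ} (hN : 0 ≤ N) (a b : E) :
    decayWeight (-N) (a + b) ≤ decayWeight (-N) a * decayWeight (-N) b := by
  unfold decayWeight
  rw [neg_neg, ← Real.mul_rpow (by positivity) (by positivity)]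
  exact Real.rpow_le_rpow (by positivity) (one_add_norm_add_le a b) hN

lemma decayWeight_neg_le_of_norm_le {E F : Type*} [NormedAddCommGroup E] [NormedAddCommGroup F]
    {N : ℝ} (hN : 0 ≤ N) {x : E} {y : F} (h : ‖x‖ ≤ ‖y‖) :
    decayWeight (-N) x ≤ decayWeight (-N) y :=
  Real.rpow_le_rpow (by positivity) (by linarith) (by linarith)

lemma decayWeight_sub_le {E : Type*} [NormedAddCommGroup E] {N : ℝ} (hN : 0 ≤ N) (a b : E) :
    decayWeight N (a - b) ≤ decayWeight N a * decayWeight (-N) b := by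
  simpa using decayWeight_le_mul hN (a - b) a

variable (g f : 𝓢(Fin d → ℝ, ℂ))

lemma continuous_stft : Continuous fun z : (Fin d → ℝ) × (Fin d → ℝ) => stft g f z.1 z.2 := by
  simp only [stft_eq_ambFourier]
  exact continuous_ambFourier unimodularCoeff_stft f g

lemma exists_stft_le_decayWeight (n : ℕ) : ∃ C : ℝ, 0 ≤ C ∧
    ∀ z : (Fin d → ℝ) × (Fin d → ℝ), ‖stft g f z.1 z.2‖ ≤ C * decayWeight n z := by
  obtain ⟨C, h0, hC⟩ := exists_ambFourier_le_decayWeight n f g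
  refine ⟨C, h0, fun z => ?_⟩
  rw [stft_eq_ambFourier]
  exact hC unimodularCoeff_stft z

lemma integrable_stft_mul {φ : (Fin d → ℝ) × (Fin d → ℝ) → ℂ} (hφ : AEStronglyMeasurable φ)
    {C : ℝ} (hC : ∀ z, ‖φ z‖ ≤ C) : Integrable fun z => stft g f z.1 z.2 * φ z := by
  obtain ⟨A, hA, H⟩ := exists_stft_le_decayWeight g f (2 * d + 1)
  refine ((integrable_decayWeight_phase d).const_mul (A * C)).mono'
    ((continuous_stft g f).aestronglyMeasurable.mul hφ) (.of_forall fun z => ?_)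
  rw [norm_mul, mul_right_comm]
  exact mul_le_mul (H z) (hC z) (norm_nonneg _) (mul_nonneg hA (decayWeight_nonneg _ _))

lemma continuous_tshift_uncurry :
    Continuous fun u : ((Fin d → ℝ) × (Fin d → ℝ)) × (Fin d → ℝ) => tshift u.1 g u.2 := by
  have := g.continuous
  simp only [tshift_eq]
  fun_prop

lemma exists_norm_le_schwartz : ∃ C : ℝ, 0 ≤ C ∧ ∀ t, ‖g t‖ ≤ C := by
  obtain ⟨C, h0, hC⟩ := g.exists_le_decayWeight 0
  exact ⟨C, h0, fun t => by simpa [decayWeight] using hC t⟩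

/-- The inversion formula for the short-time Fourier transform. -/
lemma integral_stft_mul_tshift (t : Fin d → ℝ) :
    ∫ z : (Fin d → ℝ) × (Fin d → ℝ), stft g f z.1 z.2 * tshift z g t =
      ((∫ y, ‖g y‖ ^ 2 : ℝ) : ℂ) * f t := by
  have hgc := g.continuous
  have hfc := f.continuous
  obtain ⟨Cg, -, hCg⟩ := exists_norm_le_schwartz g
  have hInt : Integrable fun z : (Fin d → ℝ) × (Fin d → ℝ) => stft g f z.1 z.2 * tshift z g t := by
    refine integrable_stft_mul g f ?_ (C := Cg) fun z => ?_
    · exact ((continuous_tshift_uncurry g).comp (by fun_prop : Continuous fun z => (z, t))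
        ).aestronglyMeasurable
    · rw [norm_tshift]; exact hCg _
  rw [Measure.volume_eq_prod] at hInt ⊢
  rw [integral_prod _ hInt]
  have inner : ∀ x : Fin d → ℝ, ∫ ω : Fin d → ℝ, stft g f x ω * tshift (x, ω) g t =
      f t * ((‖g (t - x)‖ ^ 2 : ℝ) : ℂ) := by
    intro x
    have hs : Integrable fun y => f y * (starRingEnd ℂ) (g (y - x)) := by
      refine f.integrable.mul_bdd (c := Cg) (Continuous.aestronglyMeasurable (by fun_prop))
        (.of_forall fun y => ?_)
      rw [RCLike.norm_conj]; exact hCg _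
    have hF : Integrable fun ω : Fin d → ℝ =>
        ∫ y, osc (y ⬝ᵥ ω) * (f y * (starRingEnd ℂ) (g (y - x))) := by
      simp only [← stft_eq_integral_osc]
      obtain ⟨A, hA, H⟩ := exists_stft_le_decayWeight g f (d + 1)
      refine ((integrable_decayWeight_pi d).const_mul A).mono'
        ((continuous_stft g f).comp (by fun_prop : Continuous fun ω => (x, ω))
        ).aestronglyMeasurable (.of_forall fun ω => (H (x, ω)).trans ?_)
      exact mul_le_mul_of_nonneg_left
        (decayWeight_le_of_norm_le (by positivity) (norm_snd_le (x, ω))) hA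
    have inv := integral_osc_fourier_inversion (s := fun y => f y * (starRingEnd ℂ) (g (y - x)))
      (by fun_prop) hs hF t
    simp only [← stft_eq_integral_osc] at inv
    calc _ = (∫ ω : Fin d → ℝ, osc (-(t ⬝ᵥ ω)) * stft g f x ω) * g (t - x) := by
          rw [← integral_mul_const]
          refine integral_congr_ae (.of_forall fun ω => ?_)
          simp only [tshift_eq]
          ring
      _ = _ := by
          rw [inv, mul_assoc, ← Complex.normSq_eq_conj_mul_self, Complex.normSq_eq_norm_sq]
  simp only [inner]
  rw [integral_const_mul, integral_complex_ofReal, mul_comm,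
    integral_sub_left_eq_self (fun y => ‖g y‖ ^ 2) volume t]

lemma integral_norm_sq_pos {g : 𝓢(Fin d → ℝ, ℂ)} (hg : g ≠ 0) : 0 < ∫ y, ‖g y‖ ^ 2 := by
  have hgc := g.continuous
  obtain ⟨C, h0, hC⟩ := exists_norm_le_schwartz g
  have hex : ∃ y, g y ≠ 0 := by
    by_contra! h
    exact hg (by ext y; simpa using h y)
  obtain ⟨y, hy⟩ := hex
  refine integral_pos_of_integrable_nonneg_nonzero (μ := volume) (x := y) (by fun_prop) ?_
    (fun y => by positivity) (by simpa using hy)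
  refine (g.integrable.norm.mul_bdd (c := C) hgc.norm.aestronglyMeasurable
    (.of_forall fun y => ?_)).congr (.of_forall fun y => (sq _).symm)
  rw [norm_norm]; exact hC y

lemma jb2_zero : jb2 (0 : (Fin d → ℝ) × (Fin d → ℝ)) = 1 := by simp [jb2]

lemma exists_jb2_rpow_le_decayWeight (d : ℕ) (s : ℝ) : ∃ C : ℝ, 0 < C ∧
    ∀ z : (Fin d → ℝ) × (Fin d → ℝ), jb2 z ^ s ≤ C * decayWeight (-|s|) z := by
  obtain ⟨C, h0, hC⟩ := exists_jb2_rpow_le d s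
  exact ⟨C, h0, fun z => by simpa [jb2_zero] using hC z 0⟩

lemma integrable_stft_mul_weight (s : ℝ) {N : ℝ} (hN : 0 ≤ N) (z : (Fin d → ℝ) × (Fin d → ℝ)) :
    Integrable fun w : (Fin d → ℝ) × (Fin d → ℝ) =>
      ‖stft g f w.1 w.2‖ * (jb2 w ^ s * decayWeight N (z - w)) := by
  obtain ⟨n, hn⟩ := exists_nat_ge |s|
  obtain ⟨A, hA, H⟩ := exists_stft_le_decayWeight g f (n + (2 * d + 1))
  obtain ⟨B, hB, HB⟩ := exists_jb2_rpow_le_decayWeight d s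
  refine ((integrable_decayWeight_phase d).const_mul (A * B)).mono' ?_ (.of_forall fun w => ?_)
  · exact ((continuous_stft g f).norm.mul ((continuous_jb2_rpow s).mul
      ((continuous_decayWeight N).comp (by fun_prop)))).aestronglyMeasurable
  · have e1 := Real.rpow_nonneg (jb2_pos w).le s
    have e2 := decayWeight_nonneg N (z - w)
    rw [Real.norm_of_nonneg (by positivity)]
    calc _ ≤ A * decayWeight ((n + (2 * d + 1) : ℕ) : ℝ) w * (B * decayWeight (-|s|) w * 1) :=
          mul_le_mul (H w) (mul_le_mul (HB w) (decayWeight_le_one hN _) e2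
            (mul_nonneg hB.le (decayWeight_nonneg _ _))) (by positivity)
            (mul_nonneg hA (decayWeight_nonneg _ _))
      _ = A * B * decayWeight (((n + (2 * d + 1) : ℕ) : ℝ) + -|s|) w := by
          rw [decayWeight_add]; ring
      _ ≤ _ := mul_le_mul_of_nonneg_left (decayWeight_anti (by push_cast; linarith) _)
          (by positivity)

lemma integrable_stft_mul_tshift_mul (z : (Fin d → ℝ) × (Fin d → ℝ)) :
    Integrable (Function.uncurry fun (t : Fin d → ℝ) (w : (Fin d → ℝ) × (Fin d → ℝ)) =>
      osc (t ⬝ᵥ z.2) * (starRingEnd ℂ) (g (t - z.1)) * (stft g f w.1 w.2 * tshift w g t))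
      (volume.prod volume) := by
  have hgc := g.continuous
  obtain ⟨Cg, hCg0, hCg⟩ := exists_norm_le_schwartz g
  obtain ⟨A, hA, HA⟩ := exists_stft_le_decayWeight g f (2 * d + 1)
  have k1 : Integrable fun t : Fin d → ℝ => ‖g (t - z.1)‖ :=
    (g.integrable.comp_sub_right z.1).norm
  have k2 := (integrable_decayWeight_phase d).const_mul (A * Cg)
  have k3 : Integrable (fun u : (Fin d → ℝ) × ((Fin d → ℝ) × (Fin d → ℝ)) => ‖g (u.1 - z.1)‖ *
      (A * Cg * decayWeight ((2 * d + 1 : ℕ) : ℝ) u.2)) (volume.prod volume) := k1.mul_prod k2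
  refine k3.mono' ?_ (.of_forall fun u => ?_)
  · refine Continuous.aestronglyMeasurable ?_
    have h3 : Continuous fun u : (Fin d → ℝ) × ((Fin d → ℝ) × (Fin d → ℝ)) =>
        tshift u.2 g u.1 := by
      simp only [tshift_eq]
      fun_prop
    have h4 : Continuous fun u : (Fin d → ℝ) × ((Fin d → ℝ) × (Fin d → ℝ)) =>
      stft g f u.2.1 u.2.2 := (continuous_stft g f).comp continuous_snd
    have h5 : Continuous fun u : (Fin d → ℝ) × ((Fin d → ℝ) × (Fin d → ℝ)) =>
      osc (u.1 ⬝ᵥ z.2) * (starRingEnd ℂ) (g (u.1 - z.1)) := by fun_prop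
    exact h5.mul (h4.mul h3)
  · simp only [Function.uncurry, norm_mul, norm_osc, one_mul, RCLike.norm_conj, norm_tshift]
    calc _ ≤ ‖g (u.1 - z.1)‖ * (A * decayWeight ((2 * d + 1 : ℕ) : ℝ) u.2 * Cg) :=
          mul_le_mul_of_nonneg_left (mul_le_mul (HA _) (hCg _) (norm_nonneg _)
            (mul_nonneg hA (decayWeight_nonneg _ _))) (norm_nonneg _)
      _ = _ := by ring

/-- The short-time Fourier transform is dominated by its own convolution with a rapidly decaying
kernel. -/
lemma exists_stft_le_integral {g : 𝓢(Fin d → ℝ, ℂ)} (hg : g ≠ 0) (n : ℕ) : ∃ C : ℝ, 0 ≤ C ∧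
    ∀ (f : 𝓢(Fin d → ℝ, ℂ)) (z : (Fin d → ℝ) × (Fin d → ℝ)), ‖stft g f z.1 z.2‖ ≤
      C * ∫ w : (Fin d → ℝ) × (Fin d → ℝ), ‖stft g f w.1 w.2‖ * decayWeight n (z - w) := by
  have hgc := g.continuous
  obtain ⟨B, hB, HB⟩ := exists_stft_le_decayWeight g g n
  set c := ∫ y, ‖g y‖ ^ 2 with hc
  have hcpos : 0 < c := integral_norm_sq_pos hg
  refine ⟨c⁻¹ * B, by positivity, fun f z => ?_⟩
  have key : (c : ℂ) * stft g f z.1 z.2 =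
      ∫ w : (Fin d → ℝ) × (Fin d → ℝ), stft g f w.1 w.2 * stft g (tshift w g) z.1 z.2 := by
    have e1 : (c : ℂ) * stft g f z.1 z.2 = ∫ t, ∫ w : (Fin d → ℝ) × (Fin d → ℝ),
        osc (t ⬝ᵥ z.2) * (starRingEnd ℂ) (g (t - z.1)) *
          (stft g f w.1 w.2 * tshift w g t) := by
      rw [stft_eq_integral_osc, ← integral_const_mul]
      refine integral_congr_ae (.of_forall fun t => ?_)
      simp only
      rw [integral_const_mul, integral_stft_mul_tshift, ← hc]
      ring
    rw [e1, integral_integral_swap]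
    · refine integral_congr_ae (.of_forall fun w => ?_)
      simp only
      rw [stft_eq_integral_osc g (tshift w g), ← integral_const_mul]
      refine integral_congr_ae (.of_forall fun t => ?_)
      simp only
      ring
    · exact integrable_stft_mul_tshift_mul g f z
  have h2 : c * ‖stft g f z.1 z.2‖ ≤
      B * ∫ w : (Fin d → ℝ) × (Fin d → ℝ), ‖stft g f w.1 w.2‖ * decayWeight n (z - w) := by
    have : c * ‖stft g f z.1 z.2‖ = ‖(c : ℂ) * stft g f z.1 z.2‖ := by
      rw [norm_mul, norm_real, Real.norm_of_nonneg hcpos.le]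
    rw [this, key, ← integral_const_mul]
    have hi := (integrable_stft_mul_weight g f 0 (N := n) (by positivity) z).const_mul B
    simp only [Real.rpow_zero, one_mul] at hi
    refine norm_integral_le_of_norm_le hi (.of_forall fun w => ?_)
    rw [norm_mul, norm_stft_tshift]
    calc _ ≤ ‖stft g f w.1 w.2‖ * (B * decayWeight n (z - w)) :=
          mul_le_mul_of_nonneg_left (HB (z - w)) (norm_nonneg _)
      _ = _ := by ring
  rw [mul_assoc, ← div_eq_inv_mul, le_div_iff₀' hcpos]
  exact h2

end Reproducing

section BornJordan

open scoped SchwartzMap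

variable (g f : 𝓢(Fin d → ℝ, ℂ)) {m : ℝ} {σ : (Fin d → ℝ) × (Fin d → ℝ) → ℂ}

lemma decayWeight_wig_le {N : ℝ} (hN : 0 ≤ N) (τ : ℝ) (p z w : (Fin d → ℝ) × (Fin d → ℝ))
    (y : Fin d → ℝ) :
    decayWeight N (p.1 + τ • y - z.1) * decayWeight N (p.1 - (1 - τ) • y - w.1) ≤
      decayWeight N y * decayWeight (-N) z * decayWeight (-N) w := by
  have h1 := decayWeight_mul_le hN (p.1 + τ • y - z.1) (-(p.1 - (1 - τ) • y - w.1))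
  rw [decayWeight_neg, show p.1 + τ • y - z.1 + -(p.1 - (1 - τ) • y - w.1) = y - (z.1 - w.1) by
    module] at h1
  refine h1.trans ((decayWeight_sub_le hN _ _).trans ?_)
  rw [mul_assoc]
  refine mul_le_mul_of_nonneg_left ?_ (decayWeight_nonneg _ _)
  rw [sub_eq_add_neg]
  refine (decayWeight_neg_add_le hN _ _).trans ?_
  rw [decayWeight_neg]
  exact mul_le_mul (decayWeight_neg_le_of_norm_le hN (norm_fst_le z))
    (decayWeight_neg_le_of_norm_le hN (norm_fst_le w)) (decayWeight_nonneg _ _)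
    (decayWeight_nonneg _ _)

lemma integrable_wig_stft (τ : ℝ) (z p : (Fin d → ℝ) × (Fin d → ℝ)) :
    Integrable (Function.uncurry fun (y : Fin d → ℝ) (w : (Fin d → ℝ) × (Fin d → ℝ)) =>
      osc (y ⬝ᵥ p.2) * tshift z g (p.1 + τ • y) *
        (starRingEnd ℂ) (stft g f w.1 w.2 * tshift w g (p.1 - (1 - τ) • y)))
      (volume.prod volume) := by
  have hgc := g.continuous
  obtain ⟨Cg, hCg0, hCg⟩ := g.exists_le_decayWeight (d + 1)
  obtain ⟨A, hA, HA⟩ := exists_stft_le_decayWeight g f ((d + 1) + (2 * d + 1))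
  have k1 := (integrable_decayWeight_pi d).const_mul
    (Cg * Cg * A * decayWeight (-((d + 1 : ℕ) : ℝ)) z)
  have k3 : Integrable (fun u : (Fin d → ℝ) × ((Fin d → ℝ) × (Fin d → ℝ)) =>
      (Cg * Cg * A * decayWeight (-((d + 1 : ℕ) : ℝ)) z * decayWeight ((d + 1 : ℕ) : ℝ) u.1) *
      (decayWeight ((2 * d + 1 : ℕ) : ℝ) u.2)) (volume.prod volume) :=
    k1.mul_prod (integrable_decayWeight_phase d)
  refine k3.mono' ?_ (.of_forall fun u => ?_)
  · refine Continuous.aestronglyMeasurable ?_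
    have h3 : Continuous fun u : (Fin d → ℝ) × ((Fin d → ℝ) × (Fin d → ℝ)) =>
        tshift u.2 g (p.1 - (1 - τ) • u.1) := by
      simp only [tshift_eq]
      fun_prop
    have h4 : Continuous fun u : (Fin d → ℝ) × ((Fin d → ℝ) × (Fin d → ℝ)) =>
      stft g f u.2.1 u.2.2 := (continuous_stft g f).comp continuous_snd
    have h5 : Continuous fun u : (Fin d → ℝ) × ((Fin d → ℝ) × (Fin d → ℝ)) =>
        osc (u.1 ⬝ᵥ p.2) * tshift z g (p.1 + τ • u.1) := by
      simp only [tshift_eq]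
      fun_prop
    exact h5.mul (Complex.continuous_conj.comp (h4.mul h3))
  · obtain ⟨y, w⟩ := u
    simp only [Function.uncurry, norm_mul, norm_osc, one_mul, RCLike.norm_conj, norm_tshift]
    have e1 := decayWeight_nonneg (-((d + 1 : ℕ) : ℝ)) z
    have e2 := decayWeight_nonneg ((d + 1 : ℕ) : ℝ) y
    have t1 : ‖g (p.1 + τ • y - z.1)‖ * ‖g (p.1 - (1 - τ) • y - w.1)‖ ≤
        Cg * Cg * (decayWeight ((d + 1 : ℕ) : ℝ) y * decayWeight (-((d + 1 : ℕ) : ℝ)) z *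
          decayWeight (-((d + 1 : ℕ) : ℝ)) w) := by
      refine (mul_le_mul (hCg _) (hCg _) (norm_nonneg _)
        (mul_nonneg hCg0 (decayWeight_nonneg _ _))).trans ?_
      rw [mul_mul_mul_comm]
      exact mul_le_mul_of_nonneg_left (decayWeight_wig_le (by positivity) τ p z w y)
        (by positivity)
    calc _ = ‖g (p.1 + τ • y - z.1)‖ * ‖g (p.1 - (1 - τ) • y - w.1)‖ * ‖stft g f w.1 w.2‖ := by
          ring
      _ ≤ Cg * Cg * (decayWeight ((d + 1 : ℕ) : ℝ) y * decayWeight (-((d + 1 : ℕ) : ℝ)) z *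
          decayWeight (-((d + 1 : ℕ) : ℝ)) w) *
          (A * decayWeight (((d + 1) + (2 * d + 1) : ℕ) : ℝ) w) :=
          mul_le_mul t1 (HA w) (norm_nonneg _) (mul_nonneg (by positivity)
            (mul_nonneg (by positivity) (decayWeight_nonneg _ _)))
      _ = Cg * Cg * A * decayWeight (-((d + 1 : ℕ) : ℝ)) z * decayWeight ((d + 1 : ℕ) : ℝ) y *
          decayWeight (-((d + 1 : ℕ) : ℝ) + (((d + 1) + (2 * d + 1) : ℕ) : ℝ)) w := by
          rw [decayWeight_add]; ring
      _ = _ := by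
          congr 2
          push_cast; ring

lemma integral_norm_sq_mul_wig (τ : ℝ) (z p : (Fin d → ℝ) × (Fin d → ℝ)) :
    ((∫ y, ‖g y‖ ^ 2 : ℝ) : ℂ) * wig τ (tshift z g) f p =
      ∫ w : (Fin d → ℝ) × (Fin d → ℝ), (starRingEnd ℂ) (stft g f w.1 w.2) *
        wig τ (tshift z g) (tshift w g) p := by
  have e : ∀ h : (Fin d → ℝ) → ℂ, wig τ (tshift z g) h p =
      ∫ y, osc (y ⬝ᵥ p.2) * tshift z g (p.1 + τ • y) * (starRingEnd ℂ) (h (p.1 - (1 - τ) • y)) := by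
    intro h
    rw [wig_eq_ambFourier]
    refine integral_congr_ae (.of_forall fun y => ?_)
    simp only [ambIntegrand, one_smul, neg_smul, ← sub_eq_add_neg]
  rw [e, ← integral_const_mul]
  have e1 : ∀ y, ((∫ y, ‖g y‖ ^ 2 : ℝ) : ℂ) * (osc (y ⬝ᵥ p.2) * tshift z g (p.1 + τ • y) *
      (starRingEnd ℂ) (f (p.1 - (1 - τ) • y))) = ∫ w : (Fin d → ℝ) × (Fin d → ℝ),
      osc (y ⬝ᵥ p.2) * tshift z g (p.1 + τ • y) *
        (starRingEnd ℂ) (stft g f w.1 w.2 * tshift w g (p.1 - (1 - τ) • y)) := by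
    intro y
    rw [integral_const_mul, integral_conj, integral_stft_mul_tshift, map_mul, conj_ofReal]
    ring
  simp only [e1]
  rw [integral_integral_swap (integrable_wig_stft g f τ z p)]
  refine integral_congr_ae (.of_forall fun w => ?_)
  simp only
  rw [e, ← integral_const_mul]
  refine integral_congr_ae (.of_forall fun y => ?_)
  simp only [map_mul]
  ring

lemma norm_wigCentre_sub_le {τ : ℝ} (h0 : 0 ≤ τ) (h1 : τ ≤ 1)
    (z w : (Fin d → ℝ) × (Fin d → ℝ)) : ‖wigCentre τ z w - w‖ ≤ ‖z - w‖ := by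
  have e1 : (wigCentre τ z w - w).1 = (1 - τ) • (z - w).1 := by
    simp only [wigCentre, Prod.fst_sub]; module
  have e2 : (wigCentre τ z w - w).2 = τ • (z - w).2 := by
    simp only [wigCentre, Prod.snd_sub]; module
  rw [norm_prod_le_iff, e1, e2, norm_smul, norm_smul]
  constructor
  · refine (mul_le_of_le_one_left (norm_nonneg _) ?_).trans (norm_fst_le _)
    rw [Real.norm_of_nonneg] <;> linarith
  · refine (mul_le_of_le_one_left (norm_nonneg _) ?_).trans (norm_snd_le _)
    rw [Real.norm_of_nonneg] <;> linarith

lemma conj_wig_tshift (τ : ℝ) (z w p : (Fin d → ℝ) × (Fin d → ℝ)) :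
    (starRingEnd ℂ) (wig τ (tshift z g) (tshift w g) p) =
      osc ((z.1 - w.1) ⬝ᵥ (wigCentre τ z w).2) * (osc (phasePair (z.2 - w.2, -(z.1 - w.1)) p) *
        (starRingEnd ℂ) (ambFourier 1 τ 1 (-(1 - τ)) g g (p - wigCentre τ z w))) := by
  rw [wig_tshift, map_mul, conj_osc, ← mul_assoc, ← osc_add]
  congr 2
  simp only [phasePair, dotProduct_sub, neg_dotProduct, dotProduct_comm p.1, sub_dotProduct]
  ring

/-- Off-diagonal decay of the Gabor matrix of `Op_τ(σ)`, uniformly in `τ ∈ [0,1]`. -/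
lemma SmSymbol.exists_gabor_le (hσ : SmSymbol d m σ) (n : ℕ) : ∃ C : ℝ, 0 ≤ C ∧
    ∀ {τ : ℝ}, 0 ≤ τ → τ ≤ 1 → ∀ z w : (Fin d → ℝ) × (Fin d → ℝ),
      ‖∫ p, σ p * (starRingEnd ℂ) (wig τ (tshift z g) (tshift w g) p)‖ ≤
        C * (jb2 w ^ m * decayWeight n (z - w)) := by
  obtain ⟨k, hk⟩ := exists_nat_ge |m|
  obtain ⟨C, hC0, hC⟩ := hσ.exists_norm_oscInt_le (k + n) g g
  obtain ⟨B, hB, HB⟩ := exists_jb2_rpow_le d m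
  refine ⟨C * B, by positivity, fun {τ} h0 h1 z w => ?_⟩
  have e1 : ∫ p, σ p * (starRingEnd ℂ) (wig τ (tshift z g) (tshift w g) p) =
      osc ((z.1 - w.1) ⬝ᵥ (wigCentre τ z w).2) *
        oscInt σ (ambFourier 1 τ 1 (-(1 - τ)) g g) (wigCentre τ z w)
          (z.2 - w.2, -(z.1 - w.1)) := by
    unfold oscInt
    rw [← integral_const_mul]
    refine integral_congr_ae (.of_forall fun p => ?_)
    simp only [conj_wig_tshift]
    ring
  have e2 : ‖((z.2 - w.2, -(z.1 - w.1)) : (Fin d → ℝ) × (Fin d → ℝ))‖ = ‖z - w‖ := by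
    rw [Prod.norm_def, Prod.norm_def, norm_neg, max_comm]
    rfl
  rw [e1, norm_mul, norm_osc, one_mul]
  refine (hC (unimodularCoeff_wig h0 h1) _ _).trans ?_
  have e3 : decayWeight ((k + n : ℕ) : ℝ) ((z.2 - w.2, -(z.1 - w.1)) :
      (Fin d → ℝ) × (Fin d → ℝ)) = decayWeight ((k + n : ℕ) : ℝ) (z - w) := by
    rw [decayWeight, decayWeight, e2]
  have e4 : jb2 (wigCentre τ z w) ^ m ≤ B * jb2 w ^ m * decayWeight (-|m|) (z - w) :=
    (HB _ w).trans (mul_le_mul_of_nonneg_left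
      (decayWeight_neg_le_of_norm_le (abs_nonneg m) (norm_wigCentre_sub_le h0 h1 z w))
      (mul_nonneg hB.le (Real.rpow_nonneg (jb2_pos w).le m)))
  have e5 : decayWeight (-|m|) (z - w) * decayWeight ((k + n : ℕ) : ℝ) (z - w) ≤
      decayWeight n (z - w) := by
    rw [← decayWeight_add]
    exact decayWeight_anti (by push_cast; linarith) _
  rw [e3]
  have hw := Real.rpow_nonneg (jb2_pos w).le m
  calc _ ≤ C * (B * jb2 w ^ m * decayWeight (-|m|) (z - w)) *
        decayWeight ((k + n : ℕ) : ℝ) (z - w) := by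
        refine mul_le_mul_of_nonneg_right (mul_le_mul_of_nonneg_left e4 hC0)
          (decayWeight_nonneg _ _)
    _ = C * B * (jb2 w ^ m * (decayWeight (-|m|) (z - w) *
        decayWeight ((k + n : ℕ) : ℝ) (z - w))) := by ring
    _ ≤ _ := by gcongr

end BornJordan

section BornJordanBound

open scoped SchwartzMap

variable (g f : 𝓢(Fin d → ℝ, ℂ)) {m : ℝ} {σ : (Fin d → ℝ) × (Fin d → ℝ) → ℂ}

lemma SmSymbol.exists_mul_wig_le (hσ : SmSymbol d m σ) : ∃ (C : ℝ) (M : ℕ), 0 ≤ C ∧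
    ∀ {τ : ℝ}, 0 ≤ τ → τ ≤ 1 → ∀ z w p : (Fin d → ℝ) × (Fin d → ℝ),
      ‖σ p * (starRingEnd ℂ) (wig τ (tshift z g) (tshift w g) p)‖ ≤
        C * decayWeight ((2 * d + 1 : ℕ) : ℝ) p * decayWeight (-(M : ℝ)) z *
          decayWeight (-(M : ℝ)) w ^ 2 := by
  obtain ⟨k, hk⟩ := exists_nat_ge |m|
  obtain ⟨C, hC0, hC⟩ := hσ.dirSymbol_zero.exists_norm_mul_le g g
  obtain ⟨B, hB, HB⟩ := exists_jb2_rpow_le_decayWeight d m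
  refine ⟨C * B, k + (2 * d + 1), by positivity, fun {τ} h0 h1 z w p => ?_⟩
  set M : ℝ := ((k + (2 * d + 1) : ℕ) : ℝ) with hM
  have hM0 : 0 ≤ M := Nat.cast_nonneg _
  set T := wigCentre τ z w with hT
  have e1 : ‖σ p * (starRingEnd ℂ) (wig τ (tshift z g) (tshift w g) p)‖ =
      ‖osc (phasePair (z.2 - w.2, -(z.1 - w.1)) p) * (σ p *
        (starRingEnd ℂ) (ambFourier 1 τ 1 (-(1 - τ)) g g (p - T)))‖ := by
    rw [conj_wig_tshift]
    simp only [norm_mul, norm_osc, one_mul]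
    rfl
  have e2 : decayWeight (-M) T ≤ decayWeight (-M) z * decayWeight (-M) w ^ 2 := by
    calc decayWeight (-M) T = decayWeight (-M) (w + (T - w)) := by rw [add_sub_cancel]
      _ ≤ decayWeight (-M) w * decayWeight (-M) (T - w) := decayWeight_neg_add_le hM0 _ _
      _ ≤ decayWeight (-M) w * decayWeight (-M) (z + -w) := by
          rw [← sub_eq_add_neg]
          exact mul_le_mul_of_nonneg_left (decayWeight_neg_le_of_norm_le hM0
            (norm_wigCentre_sub_le h0 h1 z w)) (decayWeight_nonneg _ _)
      _ ≤ decayWeight (-M) w * (decayWeight (-M) z * decayWeight (-M) (-w)) :=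
          mul_le_mul_of_nonneg_left (decayWeight_neg_add_le hM0 _ _) (decayWeight_nonneg _ _)
      _ = _ := by rw [decayWeight_neg]; ring
  have e3 : decayWeight (-|m|) T * decayWeight (-((2 * d + 1 : ℕ) : ℝ)) T ≤
      decayWeight (-M) T := by
    rw [← decayWeight_add]
    refine decayWeight_anti ?_ _
    rw [hM]; push_cast; linarith
  have hp := decayWeight_nonneg ((2 * d + 1 : ℕ) : ℝ) p
  rw [e1]
  refine (hC (unimodularCoeff_wig h0 h1) T _ p).trans ?_
  calc _ ≤ C * (B * decayWeight (-|m|) T) * (decayWeight ((2 * d + 1 : ℕ) : ℝ) p *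
        decayWeight (-((2 * d + 1 : ℕ) : ℝ)) T) :=
        mul_le_mul (mul_le_mul_of_nonneg_left (HB T) hC0) (decayWeight_sub_le (by positivity) _ _)
          (decayWeight_nonneg _ _) (mul_nonneg hC0 (mul_nonneg hB.le (decayWeight_nonneg _ _)))
    _ = C * B * decayWeight ((2 * d + 1 : ℕ) : ℝ) p *
        (decayWeight (-|m|) T * decayWeight (-((2 * d + 1 : ℕ) : ℝ)) T) := by ring
    _ ≤ C * B * decayWeight ((2 * d + 1 : ℕ) : ℝ) p *
        (decayWeight (-M) z * decayWeight (-M) w ^ 2) :=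
        mul_le_mul_of_nonneg_left (e3.trans e2) (by positivity)
    _ = _ := by ring

lemma stronglyMeasurable_conj_wig (z : (Fin d → ℝ) × (Fin d → ℝ)) :
    StronglyMeasurable fun u : (((Fin d → ℝ) × (Fin d → ℝ)) × ℝ) × ((Fin d → ℝ) × (Fin d → ℝ)) =>
      (starRingEnd ℂ) (wig u.1.2 (tshift z g) (tshift u.2 g) u.1.1) := by
  have hc : Continuous fun u : (((Fin d → ℝ) × (Fin d → ℝ)) × ℝ) × ((Fin d → ℝ) × (Fin d → ℝ)) =>
      wigCentre u.1.2 z u.2 := by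
    unfold wigCentre; fun_prop
  have h1 : Continuous fun u : (((Fin d → ℝ) × (Fin d → ℝ)) × ℝ) × ((Fin d → ℝ) × (Fin d → ℝ)) =>
      osc ((z.1 - u.2.1) ⬝ᵥ (u.1.1.2 - (wigCentre u.1.2 z u.2).2) - u.1.1.1 ⬝ᵥ (z.2 - u.2.2)) := by
    fun_prop
  have h2 : Continuous fun u : (((Fin d → ℝ) × (Fin d → ℝ)) × ℝ) × ((Fin d → ℝ) × (Fin d → ℝ)) =>
      (u.1.2, u.1.1 - wigCentre u.1.2 z u.2) := by
    fun_prop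
  have h3 := (stronglyMeasurable_ambFourier_coeff g g).comp_measurable h2.measurable
  refine Complex.continuous_conj.comp_stronglyMeasurable ?_
  simp only [wig_tshift]
  exact h1.stronglyMeasurable.mul h3

/-- The measure on the pairs `(p, τ)` appearing in the definition of `vOpBJ`. -/
def bornJordanMeasure (d : ℕ) : Measure (((Fin d → ℝ) × (Fin d → ℝ)) × ℝ) :=
  (volume : Measure ((Fin d → ℝ) × (Fin d → ℝ))).prod (volume.restrict (Set.Ioc (0 : ℝ) 1))

instance : SFinite (bornJordanMeasure d) := by unfold bornJordanMeasure; infer_instance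

lemma integrable_bornJordan (hσ : SmSymbol d m σ) (z : (Fin d → ℝ) × (Fin d → ℝ)) :
    Integrable (fun u : (((Fin d → ℝ) × (Fin d → ℝ)) × ℝ) × ((Fin d → ℝ) × (Fin d → ℝ)) =>
      stft g f u.2.1 u.2.2 * (σ u.1.1 *
        (starRingEnd ℂ) (wig u.1.2 (tshift z g) (tshift u.2 g) u.1.1)))
      ((bornJordanMeasure d).prod volume) := by
  obtain ⟨C, M, hC0, hC⟩ := hσ.exists_mul_wig_le g
  obtain ⟨A, hA, HA⟩ := exists_stft_le_decayWeight g f (2 * M + (2 * d + 1))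
  have k1 : Integrable (fun u : ((Fin d → ℝ) × (Fin d → ℝ)) × ℝ =>
      decayWeight ((2 * d + 1 : ℕ) : ℝ) u.1 * (1 : ℝ)) (bornJordanMeasure d) :=
    (integrable_decayWeight_phase d).mul_prod (integrable_const 1)
  have k2 := (integrable_decayWeight_phase d).const_mul (A * C * decayWeight (-(M : ℝ)) z)
  have k3 : Integrable (fun u : (((Fin d → ℝ) × (Fin d → ℝ)) × ℝ) × ((Fin d → ℝ) × (Fin d → ℝ)) =>
      decayWeight ((2 * d + 1 : ℕ) : ℝ) u.1.1 * 1 *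
      (A * C * decayWeight (-(M : ℝ)) z * decayWeight ((2 * d + 1 : ℕ) : ℝ) u.2))
      ((bornJordanMeasure d).prod volume) := k1.mul_prod k2
  have hae : ∀ᵐ u ∂((bornJordanMeasure d).prod
      (volume : Measure ((Fin d → ℝ) × (Fin d → ℝ)))), u.1.2 ∈ Set.Ioc (0 : ℝ) 1 := by
    have a1 : ∀ᵐ u ∂(bornJordanMeasure d), u.2 ∈ Set.Ioc (0 : ℝ) 1 :=
      Measure.quasiMeasurePreserving_snd.ae (ae_restrict_mem measurableSet_Ioc)
    exact Measure.quasiMeasurePreserving_fst.ae a1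
  refine k3.mono' ?_ (hae.mono fun u hu => ?_)
  · have h4 : Continuous fun u : (((Fin d → ℝ) × (Fin d → ℝ)) × ℝ) ×
      ((Fin d → ℝ) × (Fin d → ℝ)) => stft g f u.2.1 u.2.2 :=
      (continuous_stft g f).comp continuous_snd
    have h5 : Continuous fun u : (((Fin d → ℝ) × (Fin d → ℝ)) × ℝ) ×
      ((Fin d → ℝ) × (Fin d → ℝ)) => σ u.1.1 := hσ.1.continuous.comp (by fun_prop)
    exact (h4.stronglyMeasurable.mul
      (h5.stronglyMeasurable.mul (stronglyMeasurable_conj_wig g z))).aestronglyMeasurable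
  · obtain ⟨⟨p, τ⟩, w⟩ := u
    have hp := decayWeight_nonneg ((2 * d + 1 : ℕ) : ℝ) p
    have hz := decayWeight_nonneg (-(M : ℝ)) z
    rw [norm_mul]
    calc _ ≤ A * decayWeight ((2 * M + (2 * d + 1) : ℕ) : ℝ) w *
          (C * decayWeight ((2 * d + 1 : ℕ) : ℝ) p * decayWeight (-(M : ℝ)) z *
          decayWeight (-(M : ℝ)) w ^ 2) :=
          mul_le_mul (HA w) (hC hu.1.le hu.2 z w p) (norm_nonneg _)
            (mul_nonneg hA (decayWeight_nonneg _ _))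
      _ = decayWeight ((2 * d + 1 : ℕ) : ℝ) p * 1 * (A * C * decayWeight (-(M : ℝ)) z *
          decayWeight (((2 * M + (2 * d + 1) : ℕ) : ℝ) + (-(M : ℝ) + -(M : ℝ))) w) := by
          rw [decayWeight_add, decayWeight_add (-(M : ℝ))]; ring
      _ = _ := by
          congr 3
          push_cast; ring

/-- The short-time Fourier transform of `Op_BJ(σ) f` is dominated by the convolution of the
weighted short-time Fourier transform of `f` with a rapidly decaying kernel. -/
lemma SmSymbol.exists_vOpBJ_le_integral {g : 𝓢(Fin d → ℝ, ℂ)} (hg : g ≠ 0) (hσ : SmSymbol d m σ)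
    (n : ℕ) : ∃ C : ℝ, 0 ≤ C ∧
    ∀ (f : 𝓢(Fin d → ℝ, ℂ)) (z : (Fin d → ℝ) × (Fin d → ℝ)), ‖vOpBJ σ g f z.1 z.2‖ ≤
      C * ∫ w : (Fin d → ℝ) × (Fin d → ℝ), ‖stft g f w.1 w.2‖ *
        (jb2 w ^ m * decayWeight n (z - w)) := by
  obtain ⟨B, hB, HB⟩ := hσ.exists_gabor_le g n
  set c := ∫ y, ‖g y‖ ^ 2 with hc
  have hcpos : 0 < c := integral_norm_sq_pos hg
  refine ⟨c⁻¹ * B, by positivity, fun f z => ?_⟩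
  have hG := integrable_bornJordan g f hσ z
  have key : (c : ℂ) * vOpBJ σ g f z.1 z.2 = ∫ w : (Fin d → ℝ) × (Fin d → ℝ),
      ∫ u, stft g f w.1 w.2 * (σ u.1 *
        (starRingEnd ℂ) (wig u.2 (tshift z g) (tshift w g) u.1)) ∂(bornJordanMeasure d) := by
    rw [← integral_integral_swap (μ := bornJordanMeasure d) hG]
    have hG1 := hG.integral_prod_left
    rw [bornJordanMeasure] at hG1 ⊢
    rw [integral_prod _ hG1, vOpBJ, ← integral_const_mul]
    refine integral_congr_ae (.of_forall fun p => ?_)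
    simp only
    rw [intervalIntegral.integral_of_le zero_le_one, ← integral_conj, ← integral_const_mul,
      ← integral_const_mul]
    refine integral_congr_ae (.of_forall fun τ => ?_)
    have := congrArg (fun t => σ p * (starRingEnd ℂ) t) (integral_norm_sq_mul_wig g f τ z p)
    simp only [map_mul, conj_ofReal, ← hc, ← integral_conj, ← integral_const_mul, conj_conj] at this
    simp only
    calc _ = σ p * (c * (starRingEnd ℂ) (wig τ (tshift z g) f p)) := by ring
      _ = _ := by
        rw [this]
        refine integral_congr_ae (.of_forall fun w => ?_)
        simp only
        ring
  have h2 : c * ‖vOpBJ σ g f z.1 z.2‖ ≤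
      B * ∫ w : (Fin d → ℝ) × (Fin d → ℝ), ‖stft g f w.1 w.2‖ *
        (jb2 w ^ m * decayWeight n (z - w)) := by
    have : c * ‖vOpBJ σ g f z.1 z.2‖ = ‖(c : ℂ) * vOpBJ σ g f z.1 z.2‖ := by
      rw [norm_mul, norm_real, Real.norm_of_nonneg hcpos.le]
    rw [this, key, ← integral_const_mul]
    have hi := (integrable_stft_mul_weight g f m (N := n) (by positivity) z).const_mul B
    refine norm_integral_le_of_norm_le hi (hG.prod_left_ae.mono fun w hw => ?_)
    have hw0 := Real.rpow_nonneg (jb2_pos w).le m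
    have hn := decayWeight_nonneg (n : ℝ) (z - w)
    have hw' := hw
    rw [bornJordanMeasure] at hw' ⊢
    rw [integral_prod_symm _ hw']
    refine (norm_integral_le_of_norm_le_const
      (C := ‖stft g f w.1 w.2‖ * (B * (jb2 w ^ m * decayWeight n (z - w)))) ?_).trans_eq ?_
    · refine (ae_restrict_mem measurableSet_Ioc).mono fun τ hτ => ?_
      simp only
      rw [integral_const_mul, norm_mul]
      exact mul_le_mul_of_nonneg_left (HB hτ.1.le hτ.2 z w) (norm_nonneg _)
    · simp
      ring
  rw [mul_assoc, ← div_eq_inv_mul, le_div_iff₀' hcpos]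
  exact h2

end BornJordanBound

section MaximalFunction

open scoped SchwartzMap ENNReal

/-- A nonnegative function dominated by its own convolution with `kernel` satisfies the
corresponding estimate with all functions raised to a power `s ≤ 1`. -/
lemma lintegral_rpow_le_of_self_dominated {E : Type*} [AddGroup E] [MeasurableSpace E]
    {μ : Measure E} {H kernel : E → ℝ≥0∞} {A : ℝ≥0∞} {s : ℝ} (hs0 : 0 < s) (hs1 : s ≤ 1)
    (hA : A ≠ ⊤) (hmul : ∀ a b, kernel a * kernel b ≤ kernel (a + b))
    (hfin : ∀ z, ∫⁻ w, H w * kernel (z - w) ∂μ ≠ ⊤)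
    (hH : ∀ z, H z ≤ A * ∫⁻ w, H w * kernel (z - w) ∂μ) (z : E) :
    (∫⁻ w, H w * kernel (z - w) ∂μ) ^ s ≤
      A ^ (1 - s) * ∫⁻ w, (H w * kernel (z - w)) ^ s ∂μ := by
  set I := ∫⁻ w, H w * kernel (z - w) ∂μ with hI
  rcases eq_or_ne I 0 with h0 | h0
  · simp [h0, hs0]
  have hpt : ∀ w, H w * kernel (z - w) ≤ A * I := fun w => by
    calc H w * kernel (z - w) ≤ (A * ∫⁻ u, H u * kernel (w - u) ∂μ) * kernel (z - w) := by
          gcongr; exact hH w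
      _ ≤ A * ∫⁻ u, H u * kernel (w - u) * kernel (z - w) ∂μ := by
          rw [mul_assoc]
          gcongr
          exact lintegral_mul_const_le _ _
      _ ≤ A * I := by
          rw [hI]
          refine mul_le_mul_right (lintegral_mono fun u => ?_) _
          rw [mul_assoc, mul_comm (kernel _)]
          refine mul_le_mul_right ?_ _
          simpa using hmul (z - w) (w - u)
  have hAI : (A * I) ^ (1 - s) ≠ ⊤ :=
    ENNReal.rpow_ne_top_of_nonneg (by linarith) (ENNReal.mul_ne_top hA (hfin z))
  have h1 : I ≤ (A * I) ^ (1 - s) * ∫⁻ w, (H w * kernel (z - w)) ^ s ∂μ := by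
    rw [← lintegral_const_mul' _ _ hAI]
    refine lintegral_mono fun w => ?_
    calc H w * kernel (z - w) = (H w * kernel (z - w)) ^ (1 - s) * (H w * kernel (z - w)) ^ s := by
          rw [← ENNReal.rpow_add_of_nonneg _ _ (by linarith) hs0.le]; simp
      _ ≤ _ := mul_le_mul_left (ENNReal.rpow_le_rpow (hpt w) (by linarith)) _
  have h2 : I ^ (1 - s) * I ^ s = I := by
    rw [← ENNReal.rpow_add_of_nonneg _ _ (by linarith) hs0.le]; simp
  have h3 : I ^ (1 - s) ≠ 0 := by
    simp [h0, hI ▸ hfin z, ENNReal.rpow_eq_zero_iff]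
  have h4 : I ^ (1 - s) ≠ ⊤ := ENNReal.rpow_ne_top_of_nonneg (by linarith) (hfin z)
  refine (ENNReal.mul_le_mul_iff_right h3 h4).1 ?_
  rw [h2]
  refine h1.trans_eq ?_
  rw [ENNReal.mul_rpow_of_nonneg _ _ (by linarith)]
  ring

lemma ofReal_decayWeight_mul_le {E : Type*} [NormedAddCommGroup E] {N : ℝ} (hN : 0 ≤ N) (a b : E) :
    ENNReal.ofReal (decayWeight N a) * ENNReal.ofReal (decayWeight N b) ≤
      ENNReal.ofReal (decayWeight N (a + b)) := by
  rw [← ENNReal.ofReal_mul (decayWeight_nonneg _ _)]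
  exact ENNReal.ofReal_le_ofReal (decayWeight_mul_le hN a b)

/-- Peetre's inequality moves a weight through a convolution with a decaying kernel. -/
lemma exists_weighted_le_lintegral (g : 𝓢(Fin d → ℝ, ℂ)) (a b : ℝ) {N C : ℝ} {n : ℕ} (hN : 0 ≤ N)
    (hn : N + |b| ≤ n) (hC : 0 ≤ C) : ∃ C' : ℝ≥0∞, C' ≠ ⊤ ∧
    ∀ (f : 𝓢(Fin d → ℝ, ℂ)) (z : (Fin d → ℝ) × (Fin d → ℝ)) (v : ℂ), ‖v‖ ≤
      C * ∫ w : (Fin d → ℝ) × (Fin d → ℝ), ‖stft g f w.1 w.2‖ *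
        (jb2 w ^ a * decayWeight n (z - w)) →
      (‖v‖₊ : ℝ≥0∞) * ENNReal.ofReal (jb2 z ^ b) ≤
        C' * ∫⁻ w : (Fin d → ℝ) × (Fin d → ℝ), (‖stft g f w.1 w.2‖₊ : ℝ≥0∞) *
          ENNReal.ofReal (jb2 w ^ (b + a)) * ENNReal.ofReal (decayWeight N (z - w)) := by
  obtain ⟨B, hB, HB⟩ := exists_jb2_rpow_le d b
  refine ⟨ENNReal.ofReal (C * B), ENNReal.ofReal_ne_top, fun f z v hv => ?_⟩
  have hz := Real.rpow_nonneg (jb2_pos z).le b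
  have hInt := integrable_stft_mul_weight g f (b + a) hN z
  have hInt' := integrable_stft_mul_weight g f a (N := n) (by positivity) z
  have key : ‖v‖ * jb2 z ^ b ≤ C * B * ∫ w : (Fin d → ℝ) × (Fin d → ℝ),
      ‖stft g f w.1 w.2‖ * (jb2 w ^ (b + a) * decayWeight N (z - w)) := by
    refine (mul_le_mul_of_nonneg_right hv hz).trans ?_
    rw [mul_assoc, mul_assoc C, ← integral_mul_const, ← integral_const_mul B]
    refine mul_le_mul_of_nonneg_left (integral_mono (hInt'.mul_const _) (hInt.const_mul _)
      fun w => ?_) hC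
    have hw := Real.rpow_nonneg (jb2_pos w).le a
    have hw' := Real.rpow_nonneg (jb2_pos w).le b
    have e1 : decayWeight (n : ℝ) (z - w) * decayWeight (-|b|) (z - w) ≤ decayWeight N (z - w) := by
      rw [← decayWeight_add]
      exact decayWeight_anti (by linarith) _
    have e0 := decayWeight_nonneg (n : ℝ) (z - w)
    simp only
    calc ‖stft g f w.1 w.2‖ * (jb2 w ^ a * decayWeight n (z - w)) * jb2 z ^ b
        ≤ ‖stft g f w.1 w.2‖ * (jb2 w ^ a * decayWeight n (z - w)) *
            (B * jb2 w ^ b * decayWeight (-|b|) (z - w)) :=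
          mul_le_mul_of_nonneg_left (HB z w) (by positivity)
      _ = B * (‖stft g f w.1 w.2‖ * (jb2 w ^ b * jb2 w ^ a *
            (decayWeight n (z - w) * decayWeight (-|b|) (z - w)))) := by ring
      _ ≤ B * (‖stft g f w.1 w.2‖ * (jb2 w ^ b * jb2 w ^ a * decayWeight N (z - w))) := by
          gcongr
      _ = _ := by rw [← Real.rpow_add (jb2_pos w)]
  have e : ∀ (u : ℂ), (‖u‖₊ : ℝ≥0∞) = ENNReal.ofReal ‖u‖ := fun u => (ofReal_norm u).symm
  simp only [e]
  rw [← ENNReal.ofReal_mul (norm_nonneg _)]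
  refine (ENNReal.ofReal_le_ofReal key).trans_eq ?_
  rw [ENNReal.ofReal_mul (by positivity), ofReal_integral_eq_lintegral_ofReal hInt
    (.of_forall fun w => mul_nonneg (norm_nonneg _)
      (mul_nonneg (Real.rpow_nonneg (jb2_pos w).le _) (decayWeight_nonneg _ _)))]
  congr 1
  refine lintegral_congr fun w => ?_
  rw [← mul_assoc, ENNReal.ofReal_mul (mul_nonneg (norm_nonneg _)
    (Real.rpow_nonneg (jb2_pos w).le _)), ENNReal.ofReal_mul (norm_nonneg _)]

lemma lintegral_stft_ne_top (g f : 𝓢(Fin d → ℝ, ℂ)) (t : ℝ) {N : ℝ} (hN : 0 ≤ N)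
    (z : (Fin d → ℝ) × (Fin d → ℝ)) :
    ∫⁻ w : (Fin d → ℝ) × (Fin d → ℝ), (‖stft g f w.1 w.2‖₊ : ℝ≥0∞) *
      ENNReal.ofReal (jb2 w ^ t) * ENNReal.ofReal (decayWeight N (z - w)) ≠ ⊤ := by
  have h := (integrable_stft_mul_weight g f t hN z).lintegral_lt_top
  refine ne_of_lt (lt_of_eq_of_lt (lintegral_congr fun w => ?_) h)
  have e : ∀ (u : ℂ), (‖u‖₊ : ℝ≥0∞) = ENNReal.ofReal ‖u‖ := fun u => (ofReal_norm u).symm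
  rw [← mul_assoc, ENNReal.ofReal_mul (mul_nonneg (norm_nonneg _)
    (Real.rpow_nonneg (jb2_pos w).le _)), ENNReal.ofReal_mul (norm_nonneg _), e]

instance isNegInvariant_phase :
    (volume : Measure ((Fin d → ℝ) × (Fin d → ℝ))).IsNegInvariant :=
  ⟨((Measure.measurePreserving_neg volume).prod (Measure.measurePreserving_neg volume)).map_eq⟩

/-- Powers of the weighted short-time Fourier transform of `Op_BJ(σ) f` are dominated by the
convolution of the same powers of the weighted transform of `f` with an integrable kernel. -/
lemma SmSymbol.exists_vOpBJ_rpow_le {m : ℝ} {σ : (Fin d → ℝ) × (Fin d → ℝ) → ℂ}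
    {g : 𝓢(Fin d → ℝ, ℂ)} (hg : g ≠ 0) (hσ : SmSymbol d m σ) (r : ℝ) {s : ℝ} (hs0 : 0 < s)
    (hs1 : s ≤ 1) : ∃ (C : ℝ≥0∞) (kernel : (Fin d → ℝ) × (Fin d → ℝ) → ℝ≥0∞), C ≠ ⊤ ∧
    Measurable kernel ∧ (∀ w, kernel w ≠ ⊤) ∧ ∫⁻ w, kernel w ≠ ⊤ ∧
    ∀ (f : 𝓢(Fin d → ℝ, ℂ)) (z : (Fin d → ℝ) × (Fin d → ℝ)),
      ((‖vOpBJ σ g f z.1 z.2‖₊ : ℝ≥0∞) * ENNReal.ofReal (jb2 z ^ r)) ^ s ≤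
      C * ∫⁻ w : (Fin d → ℝ) × (Fin d → ℝ), ((‖stft g f (z - w).1 (z - w).2‖₊ : ℝ≥0∞) *
        ENNReal.ofReal (jb2 (z - w) ^ (r + m))) ^ s * kernel w := by
  set N : ℝ := ((2 * d + 1 : ℕ) : ℝ) / s with hNdef
  have hN : 0 ≤ N := by positivity
  obtain ⟨n₁, hn₁⟩ := exists_nat_ge (N + |r + m|)
  obtain ⟨n₂, hn₂⟩ := exists_nat_ge (N + |r|)
  obtain ⟨A₁, hA₁, HA₁⟩ := exists_stft_le_integral hg n₁
  obtain ⟨A₂, hA₂, HA₂⟩ := hσ.exists_vOpBJ_le_integral hg n₂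
  obtain ⟨B₁, hB₁, HB₁⟩ := exists_weighted_le_lintegral g 0 (r + m) hN hn₁ hA₁
  obtain ⟨B₂, hB₂, HB₂⟩ := exists_weighted_le_lintegral g m r hN hn₂ hA₂
  have hk : ∀ w : (Fin d → ℝ) × (Fin d → ℝ), ENNReal.ofReal (decayWeight N w) ^ s =
      ENNReal.ofReal (decayWeight ((2 * d + 1 : ℕ) : ℝ) w) := fun w => by
    rw [ENNReal.ofReal_rpow_of_pos (decayWeight_pos _ _)]
    congr 1
    unfold decayWeight
    rw [← Real.rpow_mul (by positivity), hNdef]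
    congr 1
    field_simp
  refine ⟨B₂ ^ s * B₁ ^ (1 - s), fun w => ENNReal.ofReal (decayWeight N w) ^ s,
    ENNReal.mul_ne_top (ENNReal.rpow_ne_top_of_nonneg hs0.le hB₂)
      (ENNReal.rpow_ne_top_of_nonneg (by linarith) hB₁), ?_,
    fun w => ENNReal.rpow_ne_top_of_nonneg hs0.le ENNReal.ofReal_ne_top, ?_, fun f z => ?_⟩
  · exact ((continuous_decayWeight N).measurable.ennreal_ofReal).pow_const s
  · simp only [hk]
    exact (integrable_decayWeight_phase d).lintegral_lt_top.ne
  · have h1 := lintegral_rpow_le_of_self_dominated hs0 hs1 hB₁ (ofReal_decayWeight_mul_le hN)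
      (lintegral_stft_ne_top g f (r + m) hN) (fun z => by
        have := HB₁ f z _ (by simpa using HA₁ f z)
        simpa only [add_zero] using this) z
    have h2 := ENNReal.rpow_le_rpow (HB₂ f z _ (HA₂ f z)) hs0.le
    refine h2.trans ?_
    rw [ENNReal.mul_rpow_of_nonneg _ _ hs0.le, mul_assoc]
    refine mul_le_mul_right (h1.trans_eq ?_) _
    congr 1
    rw [← lintegral_sub_left_eq_self _ z]
    refine lintegral_congr fun w => ?_
    rw [sub_sub_cancel, ENNReal.mul_rpow_of_nonneg _ _ hs0.le]

end MaximalFunction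

section LpQuasinorm

open scoped ENNReal

variable {X Y : Type*} [MeasurableSpace X] [MeasurableSpace Y] {μ : Measure X} {ν : Measure Y}

/-- The `L^p` quasinorm of a nonnegative function, with the supremum of all values for `p = ∞`. -/
def lpQuasinorm (μ : Measure X) (p : ℝ≥0∞) (φ : X → ℝ≥0∞) : ℝ≥0∞ :=
  if p = ∞ then ⨆ x, φ x else (∫⁻ x, φ x ^ p.toReal ∂μ) ^ (1 / p.toReal)

lemma lpQuasinorm_mono {p : ℝ≥0∞} {φ ψ : X → ℝ≥0∞} (h : ∀ x, φ x ≤ ψ x) :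
    lpQuasinorm μ p φ ≤ lpQuasinorm μ p ψ := by
  unfold lpQuasinorm
  split_ifs
  · exact iSup_mono h
  · exact ENNReal.rpow_le_rpow (lintegral_mono fun x =>
      ENNReal.rpow_le_rpow (h x) ENNReal.toReal_nonneg) (by positivity)

lemma lpQuasinorm_const_mul {p c : ℝ≥0∞} (hp : p ≠ 0) (hc : c ≠ ⊤) (φ : X → ℝ≥0∞) :
    lpQuasinorm μ p (fun x => c * φ x) = c * lpQuasinorm μ p φ := by
  unfold lpQuasinorm
  split_ifs with h
  · rw [ENNReal.mul_iSup]
  · have hp0 := ENNReal.toReal_pos hp h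
    simp only [ENNReal.mul_rpow_of_nonneg _ _ hp0.le]
    rw [lintegral_const_mul' _ _ (ENNReal.rpow_ne_top_of_nonneg hp0.le hc),
      ENNReal.mul_rpow_of_nonneg _ _ (by positivity), ← ENNReal.rpow_mul,
      mul_one_div_cancel hp0.ne', ENNReal.rpow_one]

lemma lpQuasinorm_sub_right [AddGroup X] [MeasurableAdd X] [μ.IsAddRightInvariant] (p : ℝ≥0∞)
    (φ : X → ℝ≥0∞) (a : X) : lpQuasinorm μ p (fun x => φ (x - a)) = lpQuasinorm μ p φ := by
  unfold lpQuasinorm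
  split_ifs
  · exact (Equiv.subRight a).iSup_comp (g := φ)
  · rw [lintegral_sub_right_eq_self (fun x => φ x ^ p.toReal) a]

lemma lpQuasinorm_rpow {p : ℝ≥0∞} {s : ℝ} (hs : 0 < s) (φ : X → ℝ≥0∞) :
    lpQuasinorm μ p φ ^ s = lpQuasinorm μ (p / ENNReal.ofReal s) (fun x => φ x ^ s) := by
  unfold lpQuasinorm
  have hs' : ENNReal.ofReal s ≠ 0 := by simpa using hs
  by_cases h : p = ∞
  · rw [if_pos h, if_pos (by rw [h]; exact ENNReal.top_div_of_ne_top ENNReal.ofReal_ne_top)]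
    exact (ENNReal.orderIsoRpow s hs).map_iSup φ
  · rw [if_neg h, if_neg (ENNReal.div_ne_top h hs'), ENNReal.toReal_div,
      ENNReal.toReal_ofReal hs.le, ← ENNReal.rpow_mul]
    simp only [← ENNReal.rpow_mul]
    rw [mul_div_cancel₀ _ hs.ne', one_div_div, one_div_mul_eq_div]

/-- The reverse Hölder inequality underlying Minkowski's integral inequality. -/
lemma lintegral_rpow_le_of_forall_lintegral_mul_le [SigmaFinite μ] {P : ℝ} (hP : 1 < P)
    {A : X → ℝ≥0∞} {R : ℝ≥0∞}
    (h : ∀ B : X → ℝ≥0∞, Measurable B →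
      ∫⁻ x, A x * B x ^ (P - 1) ∂μ ≤ R * (∫⁻ x, B x ^ P ∂μ) ^ (1 - 1 / P)) :
    (∫⁻ x, A x ^ P ∂μ) ^ (1 / P) ≤ R := by
  have hP0 : 0 < P := by linarith
  rw [one_div, ENNReal.rpow_inv_le_iff hP0]
  refine le_of_forall_lt fun L hL => ?_
  rw [lintegral_eq_nnreal] at hL
  simp only [lt_iSup_iff] at hL
  obtain ⟨f₀, hf₀, hL⟩ := hL
  rw [← SimpleFunc.lintegral_eq_lintegral] at hL
  obtain ⟨f, hf, hftop, hLf⟩ := exists_lt_lintegral_simpleFunc_of_lt_lintegral (f := fun x => f₀ x)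
    (by simpa using hL)
  refine hLf.trans_le ?_
  set T := ∫⁻ x, (f x : ℝ≥0∞) ∂μ with hT
  have hB : ∀ x, ((f x : ℝ≥0∞) ^ (1 / P)) ^ P = f x := fun x => by
    rw [← ENNReal.rpow_mul, one_div_mul_cancel hP0.ne', ENNReal.rpow_one]
  have hle : ∀ x, (f x : ℝ≥0∞) ^ (1 / P) ≤ A x := fun x => by
    rw [one_div, ENNReal.rpow_inv_le_iff hP0]
    exact (ENNReal.coe_le_coe.2 (hf x)).trans (hf₀ x)
  have key := h (fun x => (f x : ℝ≥0∞) ^ (1 / P))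
    (f.measurable.coe_nnreal_ennreal.pow_const _)
  simp only [hB] at key
  have hlow : T ≤ ∫⁻ x, A x * ((f x : ℝ≥0∞) ^ (1 / P)) ^ (P - 1) ∂μ := by
    refine lintegral_mono fun x => ?_
    calc (f x : ℝ≥0∞) = (f x : ℝ≥0∞) ^ (1 / P) * ((f x : ℝ≥0∞) ^ (1 / P)) ^ (P - 1) := by
          conv_lhs => rw [← hB x]
          generalize (f x : ℝ≥0∞) ^ (1 / P) = b
          nth_rw 2 [← ENNReal.rpow_one b]
          rw [← ENNReal.rpow_add_of_nonneg _ _ zero_le_one (by linarith), add_sub_cancel]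
      _ ≤ _ := mul_le_mul_left (hle x) _
  rcases eq_or_ne T 0 with h0 | h0
  · rw [h0]; exact zero_le
  have hT' : T ^ (1 - 1 / P) ≠ 0 := by simp [ENNReal.rpow_eq_zero_iff, h0, hftop.ne]
  have h1P : 0 ≤ 1 - 1 / P := by
    rw [sub_nonneg, div_le_one hP0]; exact hP.le
  have hT'' : T ^ (1 - 1 / P) ≠ ⊤ := ENNReal.rpow_ne_top_of_nonneg h1P hftop.ne
  have : T ^ (1 / P) ≤ R := by
    refine (ENNReal.mul_le_mul_iff_left hT' hT'').1 (le_trans (le_of_eq ?_) (hlow.trans key))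
    rw [← ENNReal.rpow_add_of_nonneg _ _ (by positivity) h1P, add_sub_cancel, ENNReal.rpow_one]
  rwa [one_div, ENNReal.rpow_inv_le_iff hP0] at this

/-- Minkowski's integral inequality. -/
lemma lpQuasinorm_lintegral_le [SigmaFinite μ] [SFinite ν] {p : ℝ≥0∞} (hp : 1 ≤ p)
    {φ : X → Y → ℝ≥0∞} (hφ : Measurable (Function.uncurry φ)) :
    lpQuasinorm μ p (fun x => ∫⁻ y, φ x y ∂ν) ≤ ∫⁻ y, lpQuasinorm μ p (fun x => φ x y) ∂ν := by
  unfold lpQuasinorm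
  by_cases h : p = ∞
  · simp only [if_pos h]
    exact iSup_le fun x => lintegral_mono fun y => le_iSup (fun x => φ x y) x
  simp only [if_neg h]
  have hP : 1 ≤ p.toReal := by
    simpa using (ENNReal.toReal_le_toReal ENNReal.one_ne_top h).2 hp
  generalize p.toReal = P at hP
  rcases hP.eq_or_lt with rfl | hP
  · simp only [ENNReal.rpow_one, one_div_one]
    exact (lintegral_lintegral_swap hφ.aemeasurable).le
  have hP0 : 0 < P := by linarith
  refine lintegral_rpow_le_of_forall_lintegral_mul_le hP fun B hB => ?_
  have hφx : ∀ x, Measurable (φ x) := fun x => hφ.comp measurable_prodMk_left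
  have hφy : ∀ y, Measurable fun x => φ x y := fun y => hφ.comp measurable_prodMk_right
  have hmeas : Measurable fun y => (∫⁻ x, φ x y ^ P ∂μ) ^ (1 / P) :=
    (Measurable.lintegral_prod_left' (hφ.pow_const P)).pow_const _
  calc ∫⁻ x, (∫⁻ y, φ x y ∂ν) * B x ^ (P - 1) ∂μ
      = ∫⁻ x, ∫⁻ y, φ x y * B x ^ (P - 1) ∂ν ∂μ :=
        lintegral_congr fun x => (lintegral_mul_const _ (hφx x)).symm
    _ = ∫⁻ y, ∫⁻ x, φ x y * B x ^ (P - 1) ∂μ ∂ν :=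
        lintegral_lintegral_swap (hφ.mul ((hB.comp measurable_fst).pow_const _)).aemeasurable
    _ ≤ ∫⁻ y, (∫⁻ x, φ x y ^ P ∂μ) ^ (1 / P) * (∫⁻ x, B x ^ P ∂μ) ^ (1 - 1 / P) ∂ν := by
        refine lintegral_mono fun y => ?_
        have hc := Real.HolderConjugate.conjExponent hP
        have := ENNReal.lintegral_mul_le_Lp_mul_Lq μ hc (hφy y).aemeasurable
          (hB.pow_const (P - 1)).aemeasurable
        refine this.trans_eq ?_
        have e : (P - 1) * P.conjExponent = P := by
          unfold Real.conjExponent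
          have : P - 1 ≠ 0 := by linarith
          field_simp
        have e' : 1 / P.conjExponent = 1 - 1 / P := by
          unfold Real.conjExponent
          have : P - 1 ≠ 0 := by linarith
          field_simp
        simp only [← ENNReal.rpow_mul, e, e']
    _ = _ := lintegral_mul_const _ hmeas

end LpQuasinorm

section MixedNorm

open scoped SchwartzMap ENNReal

lemma measurable_lpQuasinorm {X Y : Type*} [MeasurableSpace X] [TopologicalSpace X]
    [BorelSpace X] [TopologicalSpace Y] [MeasurableSpace Y] [BorelSpace Y]
    [SecondCountableTopologyEither X Y] {μ : Measure X} [SFinite μ] (p : ℝ≥0∞)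
    {ψ : X × Y → ℝ≥0∞} (hψ : Continuous ψ) :
    Measurable fun y => lpQuasinorm μ p fun x => ψ (x, y) := by
  unfold lpQuasinorm
  split_ifs
  · refine (lowerSemicontinuous_iSup fun x => ?_).measurable
    exact (hψ.comp (by fun_prop : Continuous fun y => (x, y))).lowerSemicontinuous
  · exact (Measurable.lintegral_prod_left' (hψ.measurable.pow_const _)).pow_const _

lemma mixedModNorm_eq_lpQuasinorm (p q : ℝ≥0∞) (r : ℝ)
    (V : (Fin d → ℝ) → (Fin d → ℝ) → ℂ) : mixedModNorm p q r V =
      lpQuasinorm volume q fun ω => lpQuasinorm volume p fun x =>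
        (‖V x ω‖₊ : ℝ≥0∞) * ENNReal.ofReal (jb2 (x, ω) ^ r) := rfl

/-- Young's inequality for mixed Lebesgue norms. -/
lemma lpQuasinorm_convolution_le {p q : ℝ≥0∞} (hp : 1 ≤ p) (hq : 1 ≤ q)
    {ψ kernel : (Fin d → ℝ) × (Fin d → ℝ) → ℝ≥0∞} (hψ : Continuous ψ) (hk : Measurable kernel)
    (hktop : ∀ w, kernel w ≠ ⊤) :
    lpQuasinorm volume q (fun ω => lpQuasinorm volume p fun x =>
      ∫⁻ w, ψ ((x, ω) - w) * kernel w) ≤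
    lpQuasinorm volume q (fun ω => lpQuasinorm volume p fun x => ψ (x, ω)) * ∫⁻ w, kernel w := by
  set Φ : (Fin d → ℝ) → ℝ≥0∞ := fun ω => lpQuasinorm volume p fun x => ψ (x, ω) with hΦ
  have hΦm : Measurable Φ := measurable_lpQuasinorm p hψ
  have hp0 : p ≠ 0 := (zero_lt_one.trans_le hp).ne'
  have hq0 : q ≠ 0 := (zero_lt_one.trans_le hq).ne'
  have inner : ∀ ω, lpQuasinorm volume p (fun x => ∫⁻ w, ψ ((x, ω) - w) * kernel w) ≤
      ∫⁻ w : (Fin d → ℝ) × (Fin d → ℝ), kernel w * Φ (ω - w.2) := fun ω => by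
    refine (lpQuasinorm_lintegral_le hp (φ := fun x w => ψ ((x, ω) - w) * kernel w) ?_).trans_eq
      (lintegral_congr fun w => ?_)
    · exact (hψ.comp (by fun_prop : Continuous fun u : (Fin d → ℝ) × (Fin d → ℝ) × (Fin d → ℝ) =>
        ((u.1, ω) - u.2))).measurable.mul (hk.comp measurable_snd)
    · simp only [mul_comm _ (kernel w)]
      rw [lpQuasinorm_const_mul hp0 (hktop w)]
      exact congrArg _ (lpQuasinorm_sub_right p (fun x => ψ (x, ω - w.2)) w.1)
  refine (lpQuasinorm_mono inner).trans ?_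
  refine (lpQuasinorm_lintegral_le hq (φ := fun ω w => kernel w * Φ (ω - w.2)) ?_).trans_eq ?_
  · exact (hk.comp measurable_snd).mul (hΦm.comp (by fun_prop))
  · rw [mul_comm, ← lintegral_mul_const _ hk]
    refine lintegral_congr fun w => ?_
    rw [lpQuasinorm_const_mul hq0 (hktop w), lpQuasinorm_sub_right]

end MixedNorm

open scoped ENNReal in

open scoped ENNReal in
/-- Boundedness of Born–Jordan operators with symbols in `S^m` from
`M^{p,q}_{⟨·⟩^{r+m}}(ℝ^d)` to `M^{p,q}_{⟨·⟩^r}(ℝ^d)`, stated on the dense class of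
Schwartz functions. -/
theorem opBJ_bounded_modulation (d : ℕ) (m r : ℝ) (p q : ℝ≥0∞) (hp : p ≠ 0) (hq : q ≠ 0)
    (g : SchwartzMap (Fin d → ℝ) ℂ) (hg : g ≠ 0)
    (σ : (Fin d → ℝ) × (Fin d → ℝ) → ℂ) (hσ : SmSymbol d m σ) :
    ∃ C : ℝ≥0∞, C ≠ ⊤ ∧ ∀ f : SchwartzMap (Fin d → ℝ) ℂ,
      mixedModNorm p q r (vOpBJ σ (⇑g) (⇑f)) ≤
        C * mixedModNorm p q (r + m) (stft (⇑g) (⇑f)) := by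
  obtain ⟨s, hs0, hs1, hsp, hsq⟩ : ∃ s : ℝ, 0 < s ∧ s ≤ 1 ∧ ENNReal.ofReal s ≤ p ∧
      ENNReal.ofReal s ≤ q := by
    have htop : min 1 (min p q) ≠ ⊤ := ne_top_of_le_ne_top ENNReal.one_ne_top (min_le_left _ _)
    have hpos : min 1 (min p q) ≠ 0 :=
      (lt_min zero_lt_one (lt_min (pos_iff_ne_zero.2 hp) (pos_iff_ne_zero.2 hq))).ne'
    refine ⟨(min 1 (min p q)).toReal, ENNReal.toReal_pos hpos htop, ?_, ?_, ?_⟩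
    · exact ENNReal.toReal_mono ENNReal.one_ne_top (min_le_left _ _)
    all_goals rw [ENNReal.ofReal_toReal htop]
    · exact (min_le_right _ _).trans (min_le_left _ _)
    · exact (min_le_right _ _).trans (min_le_right _ _)
  have hs' : ENNReal.ofReal s ≠ 0 := by simpa using hs0
  have hone : ∀ t, ENNReal.ofReal s ≤ t → 1 ≤ t / ENNReal.ofReal s := fun t ht => by
    rwa [ENNReal.le_div_iff_mul_le (.inl hs') (.inl ENNReal.ofReal_ne_top), one_mul]
  have hP := hone p hsp
  have hQ := hone q hsq
  obtain ⟨C, kernel, hC, hk, hktop, hkint, H⟩ := hσ.exists_vOpBJ_rpow_le hg r hs0 hs1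
  refine ⟨(C * ∫⁻ w, kernel w) ^ s⁻¹, ENNReal.rpow_ne_top_of_nonneg (by positivity)
    (ENNReal.mul_ne_top hC hkint), fun f => ?_⟩
  rw [← ENNReal.rpow_le_rpow_iff hs0, ENNReal.mul_rpow_of_nonneg _ _ hs0.le,
    ENNReal.rpow_inv_rpow hs0.ne']
  simp only [mixedModNorm_eq_lpQuasinorm, lpQuasinorm_rpow hs0]
  have hψ : Continuous fun z : (Fin d → ℝ) × (Fin d → ℝ) =>
      ((‖stft g f z.1 z.2‖₊ : ℝ≥0∞) * ENNReal.ofReal (jb2 z ^ (r + m))) ^ s := by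
    refine ENNReal.continuous_rpow_const.comp ?_
    have h := ENNReal.continuous_ofReal.comp
      ((continuous_stft g f).norm.mul (continuous_jb2_rpow (r + m)))
    refine h.congr fun z => ?_
    rw [Function.comp_apply, Pi.mul_apply, ENNReal.ofReal_mul (norm_nonneg _), ofReal_norm]
    rfl
  have hconv := lpQuasinorm_convolution_le hP hQ hψ hk hktop
  have hP0 : p / ENNReal.ofReal s ≠ 0 := (zero_lt_one.trans_le hP).ne'
  have hQ0 : q / ENNReal.ofReal s ≠ 0 := (zero_lt_one.trans_le hQ).ne'
  refine (lpQuasinorm_mono fun ω => lpQuasinorm_mono fun x => H f (x, ω)).trans ?_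
  simp only [lpQuasinorm_const_mul hP0 hC, lpQuasinorm_const_mul hQ0 hC]
  rw [mul_assoc, mul_comm (∫⁻ w, kernel w)]
  exact mul_le_mul_right hconv C
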